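/- If G is a connected plane graph on n vertices with minimum degree 2 that contains no nicely embedded r-family for any r ≥ 3, then G has a matching of size at least n/37. -/

import Mathlib

open Set Bornology

/-- A plane embedding of a simple graph: each vertex is mapped to a point of the
plane, each edge to an injective arc joining its endpoints; arcs avoid vertices
other than their endpoints and distinct arcs meet only at common endpoints. -/
structure PlaneEmbedding {V : Type} (G : SimpleGraph V) where
  pos : V → ℝ × ℝ
  pos_inj : Function.Injective pos
  arc : G.edgeSet → Set (ℝ × ℝ)
  arc_path : ∀ e : G.edgeSet, ∃ u v : V, (e : Sym2 V) = s(u, v) ∧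
    ∃ γ : Path (pos u) (pos v), Function.Injective ⇑γ ∧ Set.range ⇑γ = arc e
  arc_avoid : ∀ (e : G.edgeSet) (w : V), pos w ∈ arc e → w ∈ (e : Sym2 V)
  arc_inter : ∀ e f : G.edgeSet, e ≠ f → ∀ x ∈ arc e ∩ arc f,
    ∃ w : V, w ∈ (e : Sym2 V) ∧ w ∈ (f : Sym2 V) ∧ x = pos w

namespace PlaneEmbedding

variable {V : Type} {G : SimpleGraph V}

/-- The image (drawing) of the plane graph in the plane. -/
def image (P : PlaneEmbedding G) : Set (ℝ × ℝ) :=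
  Set.range P.pos ∪ ⋃ e : G.edgeSet, P.arc e

/-- A face: a connected component of the complement of the image. -/
def IsFace (P : PlaneEmbedding G) (f : Set (ℝ × ℝ)) : Prop :=
  ∃ x, x ∉ P.image ∧ f = connectedComponentIn (P.image)ᶜ x

def IsBoundedFace (P : PlaneEmbedding G) (f : Set (ℝ × ℝ)) : Prop :=
  P.IsFace f ∧ IsBounded f

def IsOuterFace (P : PlaneEmbedding G) (f : Set (ℝ × ℝ)) : Prop :=
  P.IsFace f ∧ ¬ IsBounded f

/-- The vertices on the boundary of a face `f`. -/
def boundaryVerts (P : PlaneEmbedding G) (f : Set (ℝ × ℝ)) : Set V :=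
  {v | P.pos v ∈ closure f}

/-- The weak dual: vertices are the bounded faces, two distinct faces being
adjacent when some edge lies on the boundary of both. -/
def weakDual (P : PlaneEmbedding G) :
    SimpleGraph {f : Set (ℝ × ℝ) // P.IsBoundedFace f} :=
  SimpleGraph.fromRel fun f g =>
    ∃ e : G.edgeSet, P.arc e ⊆ closure f.1 ∧ P.arc e ⊆ closure g.1

/-- `u⁺`: the bounded faces having `u` on their boundary. -/
def uPlus (P : PlaneEmbedding G) (u : V) :
    Set {f : Set (ℝ × ℝ) // P.IsBoundedFace f} :=
  {f | u ∈ P.boundaryVerts f.1}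

/-- The drawing of the subgraph induced by a set `S` of vertices. -/
def subImage (P : PlaneEmbedding G) (S : Set V) : Set (ℝ × ℝ) :=
  P.pos '' S ∪ ⋃ e ∈ {e : G.edgeSet | ∀ w, w ∈ (e : Sym2 V) → w ∈ S}, P.arc e

/-- The vertices of `S` lying on the boundary of the unbounded face of the
drawing of the subgraph induced by `S`. -/
def outerVerts (P : PlaneEmbedding G) (S : Set V) : Set V :=
  {v | v ∈ S ∧ ∃ x, x ∉ P.subImage S ∧
    ¬ IsBounded (connectedComponentIn (P.subImage S)ᶜ x) ∧
    P.pos v ∈ closure (connectedComponentIn (P.subImage S)ᶜ x)}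

/-- Remove the outer layer of vertices. -/
def peel (P : PlaneEmbedding G) (S : Set V) : Set V := S \ P.outerVerts S

/-- The embedding is (at most) `k`-outerplanar: `k` rounds of removing the
vertices on the outer boundary remove every vertex. -/
def OuterplanarAtMost (P : PlaneEmbedding G) (k : ℕ) : Prop :=
  (P.peel)^[k] Set.univ = ∅

/-- The drawing of the subgraph of all edges incident to vertices of `R`. -/
def familyImage (P : PlaneEmbedding G) (R : Set V) : Set (ℝ × ℝ) :=
  ⋃ e ∈ {e : G.edgeSet | ∃ v ∈ R, v ∈ (e : Sym2 V)}, P.arc e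

/-- `R` is nicely embedded: no bounded face of the subgraph of edges incident
to `R` strictly encloses a vertex of `G`. -/
def NicelyEmbedded (P : PlaneEmbedding G) (R : Set V) : Prop :=
  ∀ x, x ∉ P.familyImage R →
    IsBounded (connectedComponentIn (P.familyImage R)ᶜ x) →
    ∀ v : V, P.pos v ∉ connectedComponentIn (P.familyImage R)ᶜ x

/-- The facial completion: add a clique on the boundary of each bounded face. -/
def facialCompletion (P : PlaneEmbedding G) : SimpleGraph V :=
  G ⊔ SimpleGraph.fromRel fun u v =>
    ∃ f, P.IsBoundedFace f ∧ u ∈ P.boundaryVerts f ∧ v ∈ P.boundaryVerts f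

end PlaneEmbedding

/-- A tree together with a bag of vertices at each node. -/
structure Decomp (V : Type) : Type 1 where
  ι : Type
  tree : SimpleGraph ι
  isTree : tree.IsTree
  bag : ι → Set V

/-- `D` is a tree decomposition of `G`. -/
def IsTreeDecomp {V : Type} (G : SimpleGraph V) (D : Decomp V) : Prop :=
  (∀ v, ∃ i, v ∈ D.bag i) ∧
  (∀ u v, G.Adj u v → ∃ i, u ∈ D.bag i ∧ v ∈ D.bag i) ∧
  (∀ v, (D.tree.induce {i | v ∈ D.bag i}).Connected)

/-- The treewidth of a graph. -/
noncomputable def treewidth {V : Type} (G : SimpleGraph V) : ℕ :=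
  sInf {k | ∃ D : Decomp V, IsTreeDecomp G D ∧ ∀ i, (D.bag i).ncard ≤ k + 1}

/-- `D` is an embedded tree decomposition of the plane graph given by `P`. -/
def IsEmDecomp {V : Type} {G : SimpleGraph V} (P : PlaneEmbedding G)
    (D : Decomp V) : Prop :=
  IsTreeDecomp G D ∧ ∀ f, P.IsBoundedFace f → ∃ i, P.boundaryVerts f ⊆ D.bag i

/-- The em-width of a plane graph. -/
noncomputable def emwidth {V : Type} {G : SimpleGraph V}
    (P : PlaneEmbedding G) : ℕ :=
  sInf {k | ∃ D : Decomp V, IsEmDecomp P D ∧ ∀ i, (D.bag i).ncard ≤ k + 1}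

/-- A cut vertex: its removal disconnects two vertices that were connected. -/
def SimpleGraph.IsCutVertex {V : Type} (G : SimpleGraph V) (u : V) : Prop :=
  ∃ x y, ∃ (hx : x ≠ u) (hy : y ≠ u), G.Reachable x y ∧
    ¬ (G.induce {v | v ≠ u}).Reachable ⟨x, hx⟩ ⟨y, hy⟩

/-- An `r`-family: `r` vertices of degree 2 sharing the same two neighbors. -/
def IsRFamily {V : Type} (G : SimpleGraph V) (R : Set V) (r : ℕ) : Prop :=
  R.ncard = r ∧ ∃ a b : V, a ≠ b ∧ ∀ v ∈ R, G.neighborSet v = {a, b}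

/-- The difference of two points of the plane, as a complex number. -/
noncomputable def planeDiff (p z : ℝ × ℝ) : ℂ := Complex.equivRealProdCLM.symm (z - p)

/-- A complex function on the plane has a continuous logarithm on `K`. -/
def HasLog (f : ℝ × ℝ → ℂ) (K : Set (ℝ × ℝ)) : Prop :=
  ∃ g : ℝ × ℝ → ℂ, ContinuousOn g K ∧ ∀ z ∈ K, Complex.exp (g z) = f z

lemma planeDiff_ne_zero {p z : ℝ × ℝ} (h : z ≠ p) : planeDiff p z ≠ 0 := by
  simp [planeDiff, sub_eq_zero, h]

@[fun_prop]
lemma continuous_planeDiff (p : ℝ × ℝ) : Continuous (planeDiff p) := by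
  unfold planeDiff; fun_prop

lemma planeDiff_eq (p q z : ℝ × ℝ) : planeDiff p z = planeDiff q z + planeDiff p q := by
  simp only [planeDiff, ← map_add]; congr 1; abel

namespace HasLog

variable {f f₁ f₂ : ℝ × ℝ → ℂ} {K L : Set (ℝ × ℝ)}

lemma mono (h : HasLog f K) (hL : L ⊆ K) : HasLog f L :=
  let ⟨g, hg, hg'⟩ := h
  ⟨g, hg.mono hL, fun z hz => hg' z (hL hz)⟩

lemma congr (h : HasLog f₁ K) (h' : ∀ z ∈ K, f₁ z = f₂ z) : HasLog f₂ K :=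
  let ⟨g, hg, hg'⟩ := h
  ⟨g, hg, fun z hz => (hg' z hz).trans (h' z hz)⟩

lemma one : HasLog (fun _ => 1) K := ⟨fun _ => 0, continuousOn_const, by simp⟩

lemma mul (h₁ : HasLog f₁ K) (h₂ : HasLog f₂ K) : HasLog (fun z => f₁ z * f₂ z) K :=
  let ⟨g₁, hg₁, hg₁'⟩ := h₁
  let ⟨g₂, hg₂, hg₂'⟩ := h₂
  ⟨fun z => g₁ z + g₂ z, hg₁.add hg₂, fun z hz => by
    rw [Complex.exp_add, hg₁' z hz, hg₂' z hz]⟩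

lemma zpow (h : HasLog f K) (n : ℤ) : HasLog (fun z => f z ^ n) K :=
  let ⟨g, hg, hg'⟩ := h
  ⟨fun z => n * g z, continuousOn_const.mul hg, fun z hz => by
    rw [Complex.exp_int_mul, hg' z hz]⟩

lemma prod {ι : Type*} {f : ι → ℝ × ℝ → ℂ} {s : Finset ι} (h : ∀ i ∈ s, HasLog (f i) K) :
    HasLog (fun z => ∏ i ∈ s, f i z) K := by
  classical
  induction s using Finset.induction_on with
  | empty => simpa using one
  | insert a s ha ih =>
    simp only [Finset.prod_insert ha]
    exact (h a (by simp)).mul (ih fun i hi => h i (by simp [hi]))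

lemma of_continuous (hf : Continuous f) (h0 : ∀ z, f z ≠ 0) : HasLog f univ := by
  have hsc : IsSimplyConnected (univ : Set (ℝ × ℝ)) := by
    have : ContractibleSpace (univ : Set (ℝ × ℝ)) := (convex_univ).contractibleSpace ⟨0, trivial⟩
    exact (inferInstance : SimplyConnectedSpace (univ : Set (ℝ × ℝ)))
  obtain ⟨g, hg, hg'⟩ := Complex.exists_continuousOn_eqOn_exp_comp hsc isOpen_univ
    hf.continuousOn (by rintro ⟨z, -, hz⟩; exact h0 z hz)
  exact ⟨g, hg, fun z hz => hg' hz⟩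

/-- A function on an arc has a logarithm. -/
lemma of_arc {a b : ℝ × ℝ} (γ : Path a b) (hγ : Function.Injective γ)
    (hf : ContinuousOn f (range γ)) (h0 : ∀ z ∈ range γ, f z ≠ 0) : HasLog f (range γ) := by
  have hemb : Topology.IsClosedEmbedding γ := γ.continuous.isClosedEmbedding hγ
  let e := hemb.isEmbedding.toHomeomorph
  have hc : Continuous (fun z : ℝ × ℝ => f (γ (projIcc 0 1 zero_le_one z.1))) := by
    refine hf.comp_continuous (γ.continuous.comp (continuous_projIcc.comp continuous_fst)) ?_
    intro z; exact mem_range_self _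
  obtain ⟨g, hg, hg'⟩ := of_continuous hc fun z => h0 _ (mem_range_self _)
  rw [← continuousOn_univ.symm] at hg
  classical
  refine ⟨fun z => if hz : z ∈ range γ then g ((e.symm ⟨z, hz⟩ : unitInterval), 0) else 0, ?_, ?_⟩
  · rw [continuousOn_iff_continuous_domRestrict]
    have : Continuous fun z : range γ => g ((e.symm z : unitInterval), 0) := by
      refine hg.comp ?_
      exact (continuous_subtype_val.comp e.symm.continuous).prodMk continuous_const
    convert this using 2 with z
    exact dif_pos z.2
  · intro z hz
    beta_reduce
    rw [dif_pos hz, hg' _ trivial]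
    simp only [projIcc_val]
    have := e.apply_symm_apply ⟨z, hz⟩
    congr 1
    exact congrArg Subtype.val this

/-- Gluing two logarithms whose difference is constant on the overlap. -/
lemma glue {A B : Set (ℝ × ℝ)} (hA : IsClosed A) (hB : IsClosed B) {g h : ℝ × ℝ → ℂ}
    (hg : ContinuousOn g A) (hh : ContinuousOn h B) (hgf : ∀ z ∈ A, Complex.exp (g z) = f z)
    (hhf : ∀ z ∈ B, Complex.exp (h z) = f z)
    (k : ℂ) (hk : Complex.exp k = 1) (hAB : ∀ z ∈ A ∩ B, g z = h z + k) : HasLog f (A ∪ B) := by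
  classical
  refine ⟨fun z => if z ∈ A then g z else h z + k, ?_, ?_⟩
  · refine ContinuousOn.union_of_isClosed ?_ ?_ hA hB
    · exact hg.congr fun z hz => by simp [hz]
    · refine (hh.add (continuousOn_const (c := k))).congr fun z hz => ?_
      by_cases hz' : z ∈ A
      · simp [hz', hAB z ⟨hz', hz⟩]
      · simp [hz']
  · intro z hz
    by_cases hz' : z ∈ A
    · simp [hz', hgf z hz']
    · simp [hz', Complex.exp_add, hk, hhf z (hz.resolve_left hz')]

lemma exp_sub_eq_one {a b c : ℂ} (ha : Complex.exp a = c) (hb : Complex.exp b = c) :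
    Complex.exp (a - b) = 1 := by
  rw [Complex.exp_sub, ha, hb, div_self]; rw [← hb]; exact Complex.exp_ne_zero _

lemma union_of_subsingleton {A B : Set (ℝ × ℝ)} (hA : IsClosed A) (hB : IsClosed B)
    (hfA : HasLog f A) (hfB : HasLog f B) (hAB : (A ∩ B).Subsingleton) : HasLog f (A ∪ B) := by
  obtain ⟨g, hg, hg'⟩ := hfA
  obtain ⟨h, hh, hh'⟩ := hfB
  obtain hE | ⟨u, hu⟩ := hAB.eq_empty_or_singleton
  · exact glue hA hB hg hh hg' hh' 0 (by simp) (by simp [hE])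
  · have huA : u ∈ A ∩ B := by simp [hu]
    refine glue hA hB hg hh hg' hh' (g u - h u)
      (exp_sub_eq_one (hg' u huA.1) (hh' u huA.2)) ?_
    rw [hu]; rintro z rfl; ring

/-- Two functions with logarithms on both of two sets meeting in at most two points. -/
lemma exists_zpow_union {A B : Set (ℝ × ℝ)} (hA : IsClosed A) (hB : IsClosed B) {u v : ℝ × ℝ}
    (hAB : A ∩ B ⊆ {u, v}) (h1A : HasLog f₁ A) (h1B : HasLog f₁ B) (h2A : HasLog f₂ A)
    (h2B : HasLog f₂ B) : ∃ a b : ℤ, HasLog (fun z => f₁ z ^ b * f₂ z ^ (-a)) (A ∪ B) ∧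
      (a = 0 → HasLog f₁ (A ∪ B)) := by
  by_cases hs : (A ∩ B).Subsingleton
  · exact ⟨0, 0, by simpa using one, fun _ => union_of_subsingleton hA hB h1A h1B hs⟩
  have huv : u ∈ A ∩ B ∧ v ∈ A ∩ B := by
    obtain ⟨x, hx, y, hy, hxy⟩ := Set.not_subsingleton_iff.1 hs
    have h1 := hAB hx
    have h2 := hAB hy
    simp only [mem_insert_iff, mem_singleton_iff] at h1 h2
    rcases h1 with rfl | rfl <;> rcases h2 with rfl | rfl <;> tauto
  obtain ⟨g₁, hg₁, hg₁'⟩ := h1A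
  obtain ⟨h₁, hh₁, hh₁'⟩ := h1B
  obtain ⟨g₂, hg₂, hg₂'⟩ := h2A
  obtain ⟨h₂, hh₂, hh₂'⟩ := h2B
  obtain ⟨hu, hv⟩ := huv
  obtain ⟨k1u, hk1u⟩ := Complex.exp_eq_one_iff.1 (exp_sub_eq_one (hg₁' u hu.1) (hh₁' u hu.2))
  obtain ⟨k1v, hk1v⟩ := Complex.exp_eq_one_iff.1 (exp_sub_eq_one (hg₁' v hv.1) (hh₁' v hv.2))
  obtain ⟨k2u, hk2u⟩ := Complex.exp_eq_one_iff.1 (exp_sub_eq_one (hg₂' u hu.1) (hh₂' u hu.2))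
  obtain ⟨k2v, hk2v⟩ := Complex.exp_eq_one_iff.1 (exp_sub_eq_one (hg₂' v hv.1) (hh₂' v hv.2))
  set a := k1u - k1v with ha
  set b := k2u - k2v with hb
  refine ⟨a, b, ?_, ?_⟩
  · refine glue (g := fun z => b * g₁ z + ((-a : ℤ) : ℂ) * g₂ z)
      (h := fun z => b * h₁ z + ((-a : ℤ) : ℂ) * h₂ z) hA hB
      ((continuousOn_const.mul hg₁).add (continuousOn_const.mul hg₂))
      ((continuousOn_const.mul hh₁).add (continuousOn_const.mul hh₂))
      (fun z hz => ?_) (fun z hz => ?_) (((b * k1u - a * k2u : ℤ) : ℂ) * (2 * Real.pi * Complex.I))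
      (Complex.exp_int_mul_two_pi_mul_I _) ?_
    · rw [Complex.exp_add, Complex.exp_int_mul, Complex.exp_int_mul, hg₁' z hz, hg₂' z hz]
    · rw [Complex.exp_add, Complex.exp_int_mul, Complex.exp_int_mul, hh₁' z hz, hh₂' z hz]
    · intro z hz
      rcases hAB hz with rfl | rfl
      · push_cast
        linear_combination (b : ℂ) * hk1u - (a : ℂ) * hk2u
      · have : (b * k1u - a * k2u : ℤ) = b * k1v - a * k2v := by rw [ha, hb]; ring
        rw [this]
        push_cast
        linear_combination (b : ℂ) * hk1v - (a : ℂ) * hk2v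
  · intro h0
    refine glue hA hB hg₁ hh₁ hg₁' hh₁' ((k1u : ℂ) * (2 * Real.pi * Complex.I))
      (Complex.exp_int_mul_two_pi_mul_I _) ?_
    intro z hz
    rcases hAB hz with rfl | rfl
    · linear_combination hk1u
    · have : k1u = k1v := by omega
      rw [this]
      linear_combination hk1v

lemma of_finite (hK : K.Finite) (h0 : ∀ z ∈ K, f z ≠ 0) : HasLog f K :=
  ⟨fun z => Complex.log (f z), hK.continuousOn _, fun z hz => Complex.exp_log (h0 z hz)⟩

end HasLog

lemma constant_of_exp_eq_one {α : Type*} [TopologicalSpace α] {s : Set α} (hs : IsPreconnected s)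
    {k : α → ℂ} (hk : ContinuousOn k s) (h1 : ∀ z ∈ s, Complex.exp (k z) = 1) {x y : α}
    (hx : x ∈ s) (hy : y ∈ s) : k x = k y := by
  have hpi : (2 * Real.pi * Complex.I : ℂ) ≠ 0 := Complex.two_pi_I_ne_zero
  have hmem : ∀ z ∈ s, ∃ n : ℤ, k z = n * (2 * Real.pi * Complex.I) :=
    fun z hz => Complex.exp_eq_one_iff.1 (h1 z hz)
  have hre : ∀ z ∈ s, (k z / (2 * Real.pi * Complex.I)).re ∈ range ((↑) : ℤ → ℝ) := by
    intro z hz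
    obtain ⟨n, hn⟩ := hmem z hz
    exact ⟨n, by rw [hn, mul_div_cancel_right₀ _ hpi]; simp⟩
  have hc := hs.constant_of_mapsTo Int.isClosedEmbedding_coe_real.isInducing.isDiscrete_range
    (f := fun z => (k z / (2 * Real.pi * Complex.I)).re)
    (Complex.continuous_re.comp_continuousOn (hk.div_const _)) hre hx hy
  obtain ⟨n, hn⟩ := hmem x hx
  obtain ⟨m, hm⟩ := hmem y hy
  simp only [hn, hm, mul_div_cancel_right₀ _ hpi] at hc
  have : (n : ℝ) = m := by simpa using hc
  rw [hn, hm, Int.cast_injective this]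

/-- A nontrivial power has no logarithm outside a disc. -/
lemma eq_zero_of_hasLog_zpow {R : ℝ} {N : ℤ}
    (h : HasLog (fun z => planeDiff 0 z ^ N) {z | R ≤ ‖planeDiff 0 z‖}) : N = 0 := by
  obtain ⟨g, hg, hg'⟩ := h
  set r : ℝ := max R 1
  have hr : 0 < r := lt_of_lt_of_le one_pos (le_max_right _ _)
  let φ : ℝ → ℝ × ℝ := fun θ => Complex.equivRealProdCLM (r * Complex.exp (θ * Complex.I))
  have hφ : ∀ θ, planeDiff 0 (φ θ) = r * Complex.exp (θ * Complex.I) := by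
    intro θ; simp only [planeDiff, φ, sub_zero, ContinuousLinearEquiv.symm_apply_apply]
  have hφc : Continuous φ := by fun_prop
  have hmem : ∀ θ, φ θ ∈ {z | R ≤ ‖planeDiff 0 z‖} := by
    intro θ
    simp only [mem_ofPred_eq, hφ, norm_mul, Complex.norm_exp_ofReal_mul_I, mul_one,
      Complex.norm_real, Real.norm_eq_abs, abs_of_pos hr]
    exact le_max_left _ _
  have hgφ : Continuous fun θ => g (φ θ) := hg.comp_continuous hφc hmem
  have hr0 : (r : ℂ) ≠ 0 := by exact_mod_cast hr.ne'
  have hc : Continuous fun θ : ℝ => g (φ θ) - N * (θ * Complex.I) - N * Complex.log r :=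
    (hgφ.sub (by fun_prop)).sub continuous_const
  have key := constant_of_exp_eq_one (isPreconnected_univ (α := ℝ))
    (k := fun θ : ℝ => g (φ θ) - N * (θ * Complex.I) - N * Complex.log r)
    hc.continuousOn (fun θ _ => by
      have h1 : Complex.exp (g (φ θ)) = planeDiff 0 (φ θ) ^ N := hg' _ (hmem θ)
      rw [Complex.exp_sub, Complex.exp_sub, h1, hφ, Complex.exp_int_mul,
        Complex.exp_int_mul, Complex.exp_log hr0, mul_zpow, mul_div_assoc,
        div_self (zpow_ne_zero _ (Complex.exp_ne_zero _)), mul_one,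
        div_self (zpow_ne_zero _ hr0)]) (mem_univ 0) (mem_univ (2 * Real.pi))
  have h2 : φ (2 * Real.pi) = φ 0 := by
    simp [φ]
  simp only [h2] at key
  push_cast at key
  have h3 : (N : ℂ) * (2 * Real.pi * Complex.I) = 0 := by linear_combination key
  simpa [Real.pi_ne_zero] using h3

/-- If a product of powers of differences has a logarithm on `K`, then the exponents of the points
in a bounded open set with frontier in `K` sum to zero. -/
lemma sum_eq_zero_of_hasLog_of_isBounded {ι : Type*} (s : Finset ι) (p : ι → ℝ × ℝ) (n : ι → ℤ)
    {K U : Set (ℝ × ℝ)} (hK : IsClosed K) (hp : ∀ i ∈ s, p i ∉ K) (hU : IsOpen U)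
    (hUK : frontier U ⊆ K) (hUb : IsBounded U)
    (hlog : HasLog (fun z => ∏ i ∈ s, planeDiff (p i) z ^ n i) K) [DecidablePred fun i => p i ∈ U] :
    ∑ i ∈ s with p i ∈ U, n i = 0 := by
  classical
  obtain ⟨g, hg, hg'⟩ := hlog
  obtain ⟨G, hG⟩ := ContinuousMap.exists_restrict_eq hK
    ⟨K.domRestrict g, continuousOn_iff_continuous_domRestrict.1 hg⟩
  have hGg : ∀ z ∈ K, G z = g z := fun z hz => DFunLike.congr_fun hG ⟨z, hz⟩
  set a : ℝ × ℝ → ℂ := fun z =>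
    Complex.exp (G z) / ∏ i ∈ s with p i ∉ U, planeDiff (p i) z ^ n i
  set b : ℝ × ℝ → ℂ := fun z => ∏ i ∈ s with p i ∈ U, planeDiff (p i) z ^ n i
  have hclos : closure U ⊆ U ∪ K := by
    intro z hz
    by_cases hzU : z ∈ U
    · exact Or.inl hzU
    · exact Or.inr (hUK ⟨hz, by rwa [hU.interior_eq]⟩)
  have hout : ∀ z ∈ closure U, ∀ i ∈ s.filter (p · ∉ U), planeDiff (p i) z ≠ 0 := by
    intro z hz i hi
    rw [Finset.mem_filter] at hi
    refine planeDiff_ne_zero ?_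
    rintro rfl
    exact (hclos hz).elim hi.2 (hp i hi.1)
  have hin : ∀ z ∈ Uᶜ, ∀ i ∈ s.filter (p · ∈ U), planeDiff (p i) z ≠ 0 := by
    intro z hz i hi
    rw [Finset.mem_filter] at hi
    refine planeDiff_ne_zero ?_
    rintro rfl
    exact hz hi.2
  have hab : ∀ z ∈ frontier U, a z = b z := by
    intro z hz
    simp only [a, b]
    rw [hGg z (hUK hz), hg' z (hUK hz), div_eq_iff]
    · exact (Finset.prod_filter_mul_prod_filter_not s (fun i => p i ∈ U) _).symm
    · exact Finset.prod_ne_zero_iff.2 fun i hi =>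
        zpow_ne_zero _ (hout z (frontier_subset_closure hz) i hi)
  have hac : ContinuousOn a (closure U) := by
    refine ContinuousOn.div (by fun_prop) ?_ fun z hz => Finset.prod_ne_zero_iff.2 fun i hi =>
        zpow_ne_zero _ (hout z hz i hi)
    exact continuousOn_finsetProd _ fun i hi =>
      (continuous_planeDiff _).continuousOn.zpow₀ _ fun z hz => Or.inl (hout z hz i hi)
  have hbc : ContinuousOn b Uᶜ := continuousOn_finsetProd _ fun i hi =>
    (continuous_planeDiff _).continuousOn.zpow₀ _ fun z hz => Or.inl (hin z hz i hi)
  let F : ℝ × ℝ → ℂ := fun z => if z ∈ U then a z else b z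
  have hFc : Continuous F := by
    rw [← continuousOn_univ, ← (show closure U ∪ Uᶜ = univ from
      eq_univ_of_forall fun z => (em (z ∈ U)).imp (fun h => subset_closure h) id)]
    refine ContinuousOn.union_of_isClosed ?_ ?_ isClosed_closure hU.isClosed_compl
    · refine hac.congr fun z hz => ?_
      by_cases hzU : z ∈ U
      · simp [F, hzU]
      · simp [F, hzU, hab z ⟨hz, by rwa [hU.interior_eq]⟩]
    · exact hbc.congr fun z (hz : z ∉ U) => by simp [F, hz]
  have hF0 : ∀ z, F z ≠ 0 := by
    intro z
    by_cases hz : z ∈ U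
    · simp only [F, hz, if_true, a]
      exact div_ne_zero (Complex.exp_ne_zero _) (Finset.prod_ne_zero_iff.2 fun i hi =>
        zpow_ne_zero _ (hout z (subset_closure hz) i hi))
    · simp only [F, hz, if_false, b]
      exact Finset.prod_ne_zero_iff.2 fun i hi => zpow_ne_zero _ (hin z hz i hi)
  obtain ⟨R, hR⟩ : ∃ R : ℝ, ∀ z ∈ U, ‖planeDiff 0 z‖ < R := by
    obtain ⟨R, hR⟩ := hUb.isCompact_closure.exists_bound_of_continuousOn
      (continuous_planeDiff 0).continuousOn
    exact ⟨R + 1, fun z hz => (hR z (subset_closure hz)).trans_lt (lt_add_one R)⟩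
  have hlogF : HasLog b {z | R ≤ ‖planeDiff 0 z‖} :=
    ((HasLog.of_continuous hFc hF0).mono (subset_univ _)).congr fun z hz => by
      have : z ∉ U := fun h => absurd (hR z h) (not_lt.2 hz)
      simp [F, this]
  by_cases hR0 : R ≤ 0
  · have : ∀ i ∈ s.filter (p · ∈ U), False := fun i hi =>
      absurd ((hR _ (Finset.mem_filter.1 hi).2).trans_le hR0) (not_lt.2 (norm_nonneg _))
    rw [Finset.eq_empty_of_forall_notMem this, Finset.sum_empty]
  push Not at hR0
  refine eq_zero_of_hasLog_zpow (R := R) ?_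
  have hquot : HasLog (fun z => ∏ i ∈ s with p i ∈ U, (planeDiff 0 z / planeDiff (p i) z) ^ n i)
      {z | R ≤ ‖planeDiff 0 z‖} := by
    refine HasLog.prod fun i hi => ?_
    have hz0 : ∀ z ∈ {z | R ≤ ‖planeDiff 0 z‖}, planeDiff 0 z ≠ 0 := fun z hz =>
      norm_pos_iff.1 (hR0.trans_le hz)
    have hs : ∀ z ∈ {z | R ≤ ‖planeDiff 0 z‖},
        1 + (- planeDiff 0 (p i) / planeDiff 0 z) ∈ Complex.slitPlane := fun z hz => by
      refine Complex.mem_slitPlane_of_norm_lt_one ?_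
      rw [norm_div, norm_neg, div_lt_one (hR0.trans_le hz)]
      exact (hR _ (Finset.mem_filter.1 hi).2).trans_le hz
    have : HasLog (fun z => 1 + (- planeDiff 0 (p i) / planeDiff 0 z))
        {z | R ≤ ‖planeDiff 0 z‖} :=
      ⟨fun z => Complex.log (1 + (- planeDiff 0 (p i) / planeDiff 0 z)), by
        refine ContinuousOn.clog ?_ hs
        exact continuousOn_const.add
          (continuousOn_const.div (continuous_planeDiff 0).continuousOn hz0),
        fun z hz => Complex.exp_log (Complex.slitPlane_ne_zero (hs z hz))⟩
    refine (this.zpow (- n i)).congr fun z hz => ?_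
    rw [zpow_neg, ← inv_zpow]
    congr 1
    rw [planeDiff_eq (p i) 0 z, inv_eq_one_div, eq_div_iff]
    · have h0 := hz0 z hz
      have h1 := Complex.slitPlane_ne_zero (hs z hz)
      have h2 : planeDiff (p i) 0 = - planeDiff 0 (p i) := by
        simp [planeDiff]
      rw [h2]
      have h3 : planeDiff 0 z + -planeDiff 0 (p i) ≠ 0 := by
        intro h3
        apply h1
        field_simp
        simpa using h3
      field_simp
    · have h0 := hz0 z hz
      have h1 := Complex.slitPlane_ne_zero (hs z hz)
      have h2 : planeDiff (p i) 0 = - planeDiff 0 (p i) := by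
        simp [planeDiff]
      rw [h2]
      intro h3
      apply h1
      field_simp
      simpa using h3
  refine (hlogF.mul hquot).congr fun z hz => ?_
  have hzU : z ∉ U := fun h => absurd (hR z h) (not_lt.2 hz)
  rw [← Finset.prod_mul_distrib]
  have : ∀ i ∈ s.filter (p · ∈ U), planeDiff (p i) z ^ n i *
      (planeDiff 0 z / planeDiff (p i) z) ^ n i = planeDiff 0 z ^ n i := by
    intro i hi
    rw [← mul_zpow, mul_div_cancel₀ _ (hin z hzU i hi)]
  rw [Finset.prod_congr rfl this]
  have hz0 : planeDiff 0 z ≠ 0 := norm_pos_iff.1 (hR0.trans_le hz)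
  generalize s.filter (p · ∈ U) = t
  induction t using Finset.induction_on with
  | empty => simp
  | insert a t ha ih => rw [Finset.prod_insert ha, Finset.sum_insert ha, zpow_add₀ hz0, ih]

lemma isPreconnected_norm_planeDiff_gt {R : ℝ} (hR : 0 ≤ R) :
    IsPreconnected {z | R < ‖planeDiff 0 z‖} := by
  have h : {z | R < ‖planeDiff 0 z‖} = (fun q : ℝ × ℝ =>
      Complex.equivRealProdCLM (q.1 * Complex.exp (q.2 * Complex.I))) '' (Ioi R ×ˢ univ) := by
    ext z
    simp only [mem_ofPred_eq, mem_image, mem_prod, mem_Ioi, mem_univ, and_true, Prod.exists]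
    constructor
    · intro hz
      refine ⟨‖planeDiff 0 z‖, (planeDiff 0 z).arg, hz, ?_⟩
      rw [Complex.norm_mul_exp_arg_mul_I]
      simp [planeDiff]
    · rintro ⟨r, θ, hr, rfl⟩
      rw [planeDiff, sub_zero, ContinuousLinearEquiv.symm_apply_apply, norm_mul,
        Complex.norm_exp_ofReal_mul_I, mul_one, Complex.norm_real, Real.norm_eq_abs,
        abs_of_nonneg (hR.trans hr.le)]
      exact hr
  rw [h]
  exact ((convex_Ioi R).prod convex_univ).isPreconnected.image _ (by fun_prop)

lemma isOpen_component {K : Set (ℝ × ℝ)} (hK : IsClosed K) (x : ℝ × ℝ) :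
    IsOpen (connectedComponentIn Kᶜ x) := hK.isOpen_compl.connectedComponentIn

lemma mem_component_self {K : Set (ℝ × ℝ)} {x : ℝ × ℝ} (hx : x ∉ K) :
    x ∈ connectedComponentIn Kᶜ x := mem_connectedComponentIn hx

lemma notMem_of_mem_component {K : Set (ℝ × ℝ)} {x y : ℝ × ℝ}
    (h : y ∈ connectedComponentIn Kᶜ x) : y ∉ K := connectedComponentIn_subset _ _ h

lemma component_symm {K : Set (ℝ × ℝ)} {x y : ℝ × ℝ} (hx : x ∉ K)
    (h : y ∈ connectedComponentIn Kᶜ x) : x ∈ connectedComponentIn Kᶜ y := by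
  rw [← connectedComponentIn_eq h]; exact mem_component_self hx

lemma isOpen_compl_diff_component {K : Set (ℝ × ℝ)} (hK : IsClosed K) (x : ℝ × ℝ) :
    IsOpen (Kᶜ \ connectedComponentIn Kᶜ x) := by
  refine isOpen_iff_mem_nhds.2 fun z hz => ?_
  refine Filter.mem_of_superset ((isOpen_component hK z).mem_nhds (mem_component_self hz.1))
    fun w hw => ⟨notMem_of_mem_component hw, fun hwx => hz.2 ?_⟩
  rw [connectedComponentIn_eq hwx]
  exact component_symm hz.1 hw

lemma frontier_component_subset {K : Set (ℝ × ℝ)} (hK : IsClosed K) (x : ℝ × ℝ) :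
    frontier (connectedComponentIn Kᶜ x) ⊆ K := by
  intro z hz
  rw [(isOpen_component hK x).frontier_eq] at hz
  by_contra hzK
  obtain ⟨w, hw, hw'⟩ := mem_closure_iff.1 hz.1 _ (isOpen_compl_diff_component hK x) ⟨hzK, hz.2⟩
  exact hw.2 hw'

lemma frontier_compl_diff_component_subset {K : Set (ℝ × ℝ)} (hK : IsClosed K) (x : ℝ × ℝ) :
    frontier (Kᶜ \ connectedComponentIn Kᶜ x) ⊆ K := by
  intro z hz
  rw [(isOpen_compl_diff_component hK x).frontier_eq] at hz
  by_contra hzK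
  obtain ⟨w, hw, hw'⟩ := mem_closure_iff.1 hz.1 _ (isOpen_component hK x)
    (by_contra fun h => hz.2 ⟨hzK, h⟩)
  exact hw'.2 hw

/-- The complement of a compact plane set is connected near infinity. -/
lemma exists_isPreconnected_subset_compl {K : Set (ℝ × ℝ)} (hK : IsCompact K) :
    ∃ U ⊆ Kᶜ, IsOpen U ∧ IsPreconnected U ∧ IsBounded Uᶜ := by
  obtain ⟨R, hR⟩ := hK.exists_bound_of_continuousOn (continuous_planeDiff 0).continuousOn
  refine ⟨{z | max R 0 < ‖planeDiff 0 z‖}, fun z hz hzK => ?_,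
    isOpen_lt continuous_const (continuous_planeDiff 0).norm,
    isPreconnected_norm_planeDiff_gt (le_max_right R 0), ?_⟩
  · exact absurd ((le_max_left R 0).trans_lt hz) (not_lt.2 (hR z hzK))
  refine (Metric.isBounded_closedBall (x := (0 : ℝ × ℝ)) (r := max R 0)).subset fun z hz => ?_
  rw [mem_closedBall_zero_iff]
  have h1 : planeDiff 0 z = z.1 + z.2 * Complex.I := by
    rw [planeDiff, sub_zero]
    exact Complex.equivRealProd_symm_apply z
  have hz' : ‖planeDiff 0 z‖ ≤ max R 0 := not_lt.1 hz
  have h2 := Complex.abs_re_le_norm (planeDiff 0 z)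
  have h3 := Complex.abs_im_le_norm (planeDiff 0 z)
  rw [h1] at h2 h3 hz'
  simp only [Complex.add_re, Complex.ofReal_re, Complex.mul_re, Complex.I_re, mul_zero,
    Complex.ofReal_im, Complex.I_im, mul_one, sub_self, add_zero, Complex.add_im,
    Complex.mul_im, zero_add] at h2 h3
  exact Prod.norm_def z ▸ max_le (h2.trans hz') (h3.trans hz')

lemma isBounded_compl_diff_component {K : Set (ℝ × ℝ)} (hK : IsCompact K) {x : ℝ × ℝ}
    (h : ¬ IsBounded (connectedComponentIn Kᶜ x)) :
    IsBounded (Kᶜ \ connectedComponentIn Kᶜ x) := by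
  obtain ⟨U, hUK, -, hU, hb⟩ := exists_isPreconnected_subset_compl hK
  obtain ⟨w, hw, hwU⟩ : ∃ w ∈ connectedComponentIn Kᶜ x, w ∈ U := by
    by_contra! hc
    exact h (hb.subset hc)
  have hsub : U ⊆ connectedComponentIn Kᶜ x := by
    rw [connectedComponentIn_eq hw]
    exact hU.subset_connectedComponentIn hwU hUK
  exact hb.subset fun z hz hzU => hz.2 (hsub hzU)

/-- If a product of powers of differences of total degree zero has a logarithm on a compact set,
then the total degree over each complementary component is zero. -/
lemma sum_component_eq_zero_of_hasLog {ι : Type*} (s : Finset ι) (p : ι → ℝ × ℝ) (n : ι → ℤ)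
    {K : Set (ℝ × ℝ)} (hK : IsCompact K) (hp : ∀ i ∈ s, p i ∉ K) (x : ℝ × ℝ)
    (hlog : HasLog (fun z => ∏ i ∈ s, planeDiff (p i) z ^ n i) K) (hn : ∑ i ∈ s, n i = 0)
    [DecidablePred fun i => p i ∈ connectedComponentIn Kᶜ x] :
    ∑ i ∈ s with p i ∈ connectedComponentIn Kᶜ x, n i = 0 := by
  classical
  by_cases hb : IsBounded (connectedComponentIn Kᶜ x)
  · exact sum_eq_zero_of_hasLog_of_isBounded s p n hK.isClosed hp (isOpen_component hK.isClosed x)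
      (frontier_component_subset hK.isClosed x) hb hlog
  · have h1 := sum_eq_zero_of_hasLog_of_isBounded s p n hK.isClosed hp
      (isOpen_compl_diff_component hK.isClosed x)
      (frontier_compl_diff_component_subset hK.isClosed x)
      (isBounded_compl_diff_component hK hb) hlog
    rw [← Finset.sum_filter_add_sum_filter_not s (fun i => p i ∈ connectedComponentIn Kᶜ x)] at hn
    have h2 : s.filter (fun i => p i ∈ Kᶜ \ connectedComponentIn Kᶜ x) =
        s.filter (fun i => ¬ p i ∈ connectedComponentIn Kᶜ x) :=
      Finset.filter_congr fun i hi => ⟨fun h => h.2, fun h => ⟨hp i hi, h⟩⟩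
    rw [h2] at h1
    linarith

lemma HasLog.div_symm {x y : ℝ × ℝ} {K : Set (ℝ × ℝ)}
    (h : HasLog (fun z => planeDiff x z / planeDiff y z) K) :
    HasLog (fun z => planeDiff y z / planeDiff x z) K :=
  (h.zpow (-1)).congr fun z _ => by simp

/-- Eilenberg's criterion for two points to be separated by a compact plane set. -/
theorem hasLog_div_iff {K : Set (ℝ × ℝ)} (hK : IsCompact K) {x y : ℝ × ℝ} (hx : x ∉ K)
    (hy : y ∉ K) : HasLog (fun z => planeDiff x z / planeDiff y z) K ↔
      y ∈ connectedComponentIn Kᶜ x := by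
  classical
  constructor
  · intro h
    by_contra hxy
    have hne : x ≠ y := by rintro rfl; exact hxy (mem_component_self hx)
    have := sum_component_eq_zero_of_hasLog {x, y} id (fun w => if w = x then 1 else -1) hK
      (by simp [hx, hy]) x (h.congr fun z _ => by
        simp [Finset.prod_pair hne, hne.symm, div_eq_mul_inv]) (by
        simp [Finset.sum_pair hne, hne.symm])
    rw [Finset.filter_insert, Finset.filter_singleton] at this
    simp [hxy, mem_component_self hx] at this
  · intro h
    refine (isPreconnected_connectedComponentIn (x := x) (F := Kᶜ)).induction₂
      (fun a b => HasLog (fun z => planeDiff a z / planeDiff b z) K) ?_ ?_ ?_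
      (mem_component_self hx) h
    · intro a ha
      have haK := notMem_of_mem_component ha
      obtain ⟨c, hc, hcK⟩ := hK.exists_forall_le' (continuous_planeDiff a).norm.continuousOn
        fun z hz => norm_pos_iff.2 (planeDiff_ne_zero fun h => haK (h ▸ hz))
      have hcont : Continuous fun b => ‖planeDiff b a‖ := by unfold planeDiff; fun_prop
      have hev : ∀ᶠ b in nhds a, ‖planeDiff b a‖ < c :=
        hcont.continuousAt.eventually_lt continuousAt_const (by simpa [planeDiff] using hc)
      filter_upwards [nhdsWithin_le_nhds hev] with b hb
      have h0 : ∀ z ∈ K, planeDiff a z ≠ 0 := fun z hz => norm_pos_iff.1 (hc.trans_le (hcK z hz))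
      have hs : ∀ z ∈ K, 1 + planeDiff b a / planeDiff a z ∈ Complex.slitPlane := fun z hz => by
        refine Complex.mem_slitPlane_of_norm_lt_one ?_
        rw [norm_div, div_lt_one (hc.trans_le (hcK z hz))]
        exact hb.trans_le (hcK z hz)
      refine HasLog.div_symm ⟨fun z => Complex.log (1 + planeDiff b a / planeDiff a z),
        ContinuousOn.clog (continuousOn_const.add
          (continuousOn_const.div (continuous_planeDiff a).continuousOn h0)) hs, fun z hz => ?_⟩
      rw [Complex.exp_log (Complex.slitPlane_ne_zero (hs z hz))]
      beta_reduce
      rw [planeDiff_eq b a z, add_div, div_self (h0 z hz)]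
    · intro a b c _ hb _ hab hbc
      refine (hab.mul hbc).congr fun z hz => ?_
      have : planeDiff b z ≠ 0 := planeDiff_ne_zero fun h => notMem_of_mem_component hb (h ▸ hz)
      field_simp
    · intro a b _ _ hab
      exact hab.div_symm

lemma continuous_planeDiff_uncurry :
    Continuous fun q : (ℝ × ℝ) × (ℝ × ℝ) => planeDiff q.1 q.2 := by
  unfold planeDiff; fun_prop

lemma hasLog_compl_range {u v : ℝ × ℝ} (γ : Path u v) :
    HasLog (fun z => planeDiff u z / planeDiff v z) (range γ)ᶜ := by
  classical
  have hne : ∀ (t : unitInterval) (z : ((range γ)ᶜ : Set (ℝ × ℝ))), planeDiff (γ t) z ≠ 0 :=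
    fun t z => planeDiff_ne_zero fun h => z.2 ⟨t, h.symm⟩
  have hne0 : ∀ z : ((range γ)ᶜ : Set (ℝ × ℝ)), planeDiff u z ≠ 0 := fun z => by
    simpa using hne 0 z
  have hH : Continuous fun q : unitInterval × ((range γ)ᶜ : Set (ℝ × ℝ)) =>
      planeDiff (γ q.1) q.2 / planeDiff u q.2 := by
    refine Continuous.div ?_ ?_ fun q => hne0 q.2
    · exact continuous_planeDiff_uncurry.comp (f := fun q : unitInterval ×
        ((range γ)ᶜ : Set (ℝ × ℝ)) => (γ q.1, (q.2 : ℝ × ℝ)))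
        ((γ.continuous.comp continuous_fst).prodMk (continuous_subtype_val.comp continuous_snd))
    · exact (continuous_planeDiff u).comp (continuous_subtype_val.comp continuous_snd)
  let H : C(unitInterval × ((range γ)ᶜ : Set (ℝ × ℝ)), {z : ℂ // z ≠ 0}) :=
    ⟨fun q => ⟨planeDiff (γ q.1) q.2 / planeDiff u q.2, div_ne_zero (hne _ _) (hne0 _)⟩,
      hH.subtype_mk _⟩
  let f : C(((range γ)ᶜ : Set (ℝ × ℝ)), ℂ) := ContinuousMap.const _ 0
  have H0 : ∀ a, H (0, a) = ⟨_, Complex.exp_ne_zero (f a)⟩ := fun a => by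
    apply Subtype.ext
    simp [H, f, div_self (hne0 a)]
  let L := Complex.isCoveringMap_exp.liftHomotopy H f H0
  have hL := Complex.isCoveringMap_exp.liftHomotopy_lifts H f H0
  refine HasLog.div_symm ⟨fun z => if h : z ∈ (range γ)ᶜ then L (1, ⟨z, h⟩) else 0, ?_, ?_⟩
  · rw [continuousOn_iff_continuous_domRestrict]
    have : Continuous fun z : ((range γ)ᶜ : Set (ℝ × ℝ)) => L (1, z) := by fun_prop
    convert this using 2 with z
    exact dif_pos z.2
  · intro z hz
    beta_reduce
    rw [dif_pos hz]
    have := congr_fun hL (1, ⟨z, hz⟩)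
    refine (congr_arg Subtype.val this).trans ?_
    simp [H]

lemma mem_segment_of_mem_uIcc {a b : ℝ × ℝ} {γ : Path a b} (hγ : Function.Injective γ)
    {p q r : unitInterval} (hseg : segment ℝ (γ p) (γ r) ⊆ range γ) (hq : q ∈ uIcc p r) :
    γ q ∈ segment ℝ (γ p) (γ r) := by
  let e := (γ.continuous.isClosedEmbedding hγ).isEmbedding.toHomeomorph
  have he : ∀ t, e.symm ⟨γ t, mem_range_self t⟩ = t := fun t => e.symm_apply_apply t
  have hpre : IsPreconnected ((fun z : range γ => e.symm z) ''
      ((↑) ⁻¹' segment ℝ (γ p) (γ r) : Set (range γ))) := by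
    refine IsPreconnected.image ?_ _ e.symm.continuous.continuousOn
    refine Topology.IsInducing.subtypeVal.isPreconnected_image.1 ?_
    rw [Subtype.image_preimage_coe, inter_eq_right.2 hseg]
    exact (convex_segment _ _).isPreconnected
  have hmem : q ∈ (fun z : range γ => e.symm z) ''
      ((↑) ⁻¹' segment ℝ (γ p) (γ r) : Set (range γ)) := by
    refine hpre.ordConnected.uIcc_subset ?_ ?_ hq
    · exact ⟨⟨γ p, mem_range_self p⟩, left_mem_segment _ _ _, he p⟩
    · exact ⟨⟨γ r, mem_range_self r⟩, right_mem_segment _ _ _, he r⟩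
  obtain ⟨z, hz, hzq⟩ := hmem
  have : z = ⟨γ q, mem_range_self q⟩ := by rw [← he q] at hzq; exact e.symm.injective hzq
  rwa [this] at hz

/-- An arc in the plane has empty interior. -/
lemma dense_compl_range {a b : ℝ × ℝ} {γ : Path a b} (hγ : Function.Injective γ) :
    Dense (range γ)ᶜ := by
  rw [← interior_eq_empty_iff_dense_compl]
  by_contra! hne
  obtain ⟨c, hc⟩ := hne
  obtain ⟨ε, hε, hball⟩ := Metric.mem_nhds_iff.1 (mem_interior_iff_mem_nhds.1 hc)
  have hmem : ∀ x y : ℝ, |x| < ε → |y| < ε → c + (x, y) ∈ Metric.ball c ε := fun x y hx hy => by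
    rw [Metric.mem_ball, dist_eq_norm, add_sub_cancel_left, Prod.norm_def]
    exact max_lt hx hy
  have h2 : |ε / 2| < ε := by rw [abs_of_pos (half_pos hε)]; exact half_lt_self hε
  have h0 : |(0 : ℝ)| < ε := by simpa
  obtain ⟨p, hp⟩ := hball (hmem 0 0 h0 h0)
  obtain ⟨q, hq⟩ := hball (hmem (ε / 2) 0 h2 h0)
  obtain ⟨r, hr⟩ := hball (hmem 0 (ε / 2) h0 h2)
  have hseg : ∀ s t : unitInterval, γ s ∈ Metric.ball c ε → γ t ∈ Metric.ball c ε →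
      segment ℝ (γ s) (γ t) ⊆ range γ := fun s t hs ht =>
    ((convex_ball c ε).segment_subset hs ht).trans hball
  have hpB : γ p ∈ Metric.ball c ε := hp ▸ hmem 0 0 h0 h0
  have hqB : γ q ∈ Metric.ball c ε := hq ▸ hmem (ε / 2) 0 h2 h0
  have hrB : γ r ∈ Metric.ball c ε := hr ▸ hmem 0 (ε / 2) h0 h2
  have hcase : q ∈ uIcc p r ∨ p ∈ uIcc q r ∨ r ∈ uIcc p q := by
    simp only [mem_uIcc]
    rcases le_total p q with h1 | h1 <;> rcases le_total q r with h2 | h2 <;>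
      rcases le_total p r with h3 | h3 <;> tauto
  rcases hcase with h | h | h
  · obtain ⟨s, t, hs, ht, hst, he⟩ := mem_segment_of_mem_uIcc hγ (hseg _ _ hpB hrB) h
    rw [hp, hq, hr] at he
    have e1 := congr_arg Prod.fst he
    simp at e1
    have : s * c.1 + t * c.1 = c.1 := by rw [← add_mul, hst, one_mul]
    linarith
  · obtain ⟨s, t, hs, ht, hst, he⟩ := mem_segment_of_mem_uIcc hγ (hseg _ _ hqB hrB) h
    rw [hp, hq, hr] at he
    have e1 := congr_arg Prod.fst he
    have e2 := congr_arg Prod.snd he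
    simp at e1 e2
    have h3 : s * c.1 + t * c.1 = c.1 := by rw [← add_mul, hst, one_mul]
    have h4 : s * c.2 + t * c.2 = c.2 := by rw [← add_mul, hst, one_mul]
    have h5 : s * (ε / 2) = 0 := by linarith
    have h6 : t * (ε / 2) = 0 := by linarith
    have : (s + t) * (ε / 2) = 0 := by linarith
    rw [hst] at this
    linarith
  · obtain ⟨s, t, hs, ht, hst, he⟩ := mem_segment_of_mem_uIcc hγ (hseg _ _ hpB hqB) h
    rw [hp, hq, hr] at he
    have e1 := congr_arg Prod.snd he
    simp at e1
    have : s * c.2 + t * c.2 = c.2 := by rw [← add_mul, hst, one_mul]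
    linarith

lemma not_hasLog_compl_pair {u v : ℝ × ℝ} (huv : u ≠ v) :
    ¬ HasLog (fun z => planeDiff u z / planeDiff v z) {u, v}ᶜ := by
  classical
  intro h
  have hd : 0 < dist u v / 2 := half_pos (dist_pos.2 huv)
  have h1 : u ∉ Metric.sphere u (dist u v / 2) := by simp [hd.ne]
  have h2 : v ∉ Metric.sphere u (dist u v / 2) := by
    rw [Metric.mem_sphere, dist_comm]; linarith
  have h3 : v ∉ Metric.ball u (dist u v / 2) := by
    rw [Metric.mem_ball, dist_comm]; linarith
  have := sum_eq_zero_of_hasLog_of_isBounded {u, v} id (fun w => if w = u then 1 else -1)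
    (K := Metric.sphere u (dist u v / 2)) (U := Metric.ball u (dist u v / 2))
    Metric.isClosed_sphere (by simp only [Finset.mem_insert, Finset.mem_singleton]
                               rintro i (rfl | rfl) <;> assumption) Metric.isOpen_ball
    (frontier_ball u hd.ne').subset Metric.isBounded_ball
    ((h.mono (by
      rintro z hz (rfl | rfl)
      · exact h1 hz
      · exact h2 hz)).congr fun z _ => by
        simp [Finset.prod_pair huv, huv.symm, div_eq_mul_inv])
  rw [Finset.filter_insert, Finset.filter_singleton] at this
  simp only [id, h3, Metric.mem_ball_self hd, if_true,
    if_false] at this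
  simp at this

/-- If the endpoints of an arc are not separated by the complement of `K`, adding the arc to `K`
separates two points of any dense set that were not separated by `K`. -/
theorem exists_separated_of_arc {K : Set (ℝ × ℝ)} (hK : IsClosed K) {u v : ℝ × ℝ} (huv : u ≠ v)
    (γ : Path u v) (hγ : K ∩ range γ ⊆ {u, v})
    (hlog : HasLog (fun z => planeDiff u z / planeDiff v z) Kᶜ) {X : Set (ℝ × ℝ)} (hX : Dense X)
    (hXK : X ⊆ (K ∪ range γ)ᶜ) : ∃ x ∈ X, ∃ y ∈ X, y ∈ connectedComponentIn Kᶜ x ∧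
      y ∉ connectedComponentIn (K ∪ range γ)ᶜ x := by
  classical
  by_contra! hcon
  refine not_hasLog_compl_pair huv ?_
  have hR : IsClosed (range γ) := (isCompact_range γ.continuous).isClosed
  have hKR : IsOpen (K ∪ range γ)ᶜ := (hK.union hR).isOpen_compl
  obtain ⟨g₁, hg₁, hg₁'⟩ := hasLog_compl_range γ
  obtain ⟨g₂, hg₂, hg₂'⟩ := hlog
  have hsub1 : (K ∪ range γ)ᶜ ⊆ (range γ)ᶜ := compl_subset_compl.2 subset_union_right
  have hsub2 : (K ∪ range γ)ᶜ ⊆ Kᶜ := compl_subset_compl.2 subset_union_left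
  have hch : ∀ z, z ∉ K → ∃ x ∈ X, x ∈ connectedComponentIn Kᶜ z := fun z hz => by
    obtain ⟨x, hx, hx'⟩ := hX.inter_open_nonempty _ (isOpen_component hK z)
      ⟨z, mem_component_self hz⟩
    exact ⟨x, hx', hx⟩
  let c : Set (ℝ × ℝ) → ℝ × ℝ := fun C => if h : ∃ x ∈ X, x ∈ C then h.choose else 0
  have hc : ∀ z, z ∉ K → c (connectedComponentIn Kᶜ z) ∈ X ∧
      c (connectedComponentIn Kᶜ z) ∈ connectedComponentIn Kᶜ z := fun z hz => by
    simp only [c, dif_pos (hch z hz)]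
    exact (hch z hz).choose_spec
  let k : ℝ × ℝ → ℂ := fun z =>
    g₁ (c (connectedComponentIn Kᶜ z)) - g₂ (c (connectedComponentIn Kᶜ z))
  have hk1 : ∀ z, z ∉ K → Complex.exp (k z) = 1 := fun z hz =>
    HasLog.exp_sub_eq_one (hg₁' _ (hsub1 (hXK (hc z hz).1))) (hg₂' _ (hsub2 (hXK (hc z hz).1)))
  have hkc : ContinuousOn k Kᶜ := fun z hz => by
    refine ContinuousAt.continuousWithinAt ?_
    refine (continuousAt_const (y := k z)).congr ?_
    filter_upwards [(isOpen_component hK z).mem_nhds (mem_component_self hz)] with w hw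
    simp only [k, connectedComponentIn_eq hw]
  let h : ℝ × ℝ → ℂ := fun z => g₂ z + k z
  have hh : ContinuousOn h Kᶜ := hg₂.add hkc
  have hX' : ∀ x ∈ X, g₁ x = h x := fun x hx => by
    have hxK : x ∉ K := hsub2 (hXK hx)
    have h1 := hcon x hx _ (hc x hxK).1 (hc x hxK).2
    have h2 := constant_of_exp_eq_one (isPreconnected_connectedComponentIn (x := x)
      (F := (K ∪ range γ)ᶜ)) (k := fun z => g₁ z - g₂ z)
      (((hg₁.mono hsub1).sub (hg₂.mono hsub2)).mono
        (connectedComponentIn_subset _ _)) (fun z hz => HasLog.exp_sub_eq_one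
        (hg₁' z (hsub1 (connectedComponentIn_subset _ _ hz)))
        (hg₂' z (hsub2 (connectedComponentIn_subset _ _ hz)))) (mem_component_self (hXK hx)) h1
    simp only [h, k, ← h2]
    ring
  have heq : ∀ z ∈ (K ∪ range γ)ᶜ, g₁ z = h z := by
    intro z hz
    have h1 : ContinuousOn (fun z => g₁ z - h z) (K ∪ range γ)ᶜ :=
      (hg₁.mono hsub1).sub (hh.mono hsub2)
    by_contra hne
    have h2 := h1.isOpen_inter_preimage hKR (isOpen_compl_singleton (x := (0 : ℂ)))
    obtain ⟨x, hx, hxX⟩ := hX.inter_open_nonempty _ h2 ⟨z, hz, sub_ne_zero.2 hne⟩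
    exact hx.2 (sub_eq_zero.2 (hX' x hxX))
  refine ⟨fun z => if z ∈ K then g₁ z else h z, fun z hz => ContinuousAt.continuousWithinAt ?_,
    fun z hz => ?_⟩
  · by_cases hzK : z ∈ K
    · have hzR : z ∈ (range γ)ᶜ := fun hzR => hz (hγ ⟨hzK, hzR⟩)
      refine (hg₁.continuousAt (hR.isOpen_compl.mem_nhds hzR)).congr ?_
      filter_upwards [hR.isOpen_compl.mem_nhds hzR] with w hw
      split_ifs with hwK
      · rfl
      · exact heq w fun h => h.elim hwK hw
    · refine (hh.continuousAt (hK.isOpen_compl.mem_nhds hzK)).congr ?_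
      filter_upwards [hK.isOpen_compl.mem_nhds hzK] with w hw
      exact (if_neg hw).symm
  · beta_reduce
    split_ifs with hzK
    · exact hg₁' z fun hzR => hz (hγ ⟨hzK, hzR⟩)
    · rw [Complex.exp_add, hk1 z hzK, mul_one, hg₂' z hzK]

/-- Adding an arc merges only the classes on its two sides. -/
theorem mem_component_of_separated {K R : Set (ℝ × ℝ)} (hK : IsCompact K) {u v : ℝ × ℝ}
    {γ : Path u v} (hγi : Function.Injective γ) (hR : range γ = R) (hKR : K ∩ R ⊆ {u, v})
    {x y z w : ℝ × ℝ} (hx : x ∉ K ∪ R) (hy : y ∉ K ∪ R) (hz : z ∉ K ∪ R) (hw : w ∉ K ∪ R)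
    (hxy : y ∈ connectedComponentIn Kᶜ x) (hxy' : y ∉ connectedComponentIn (K ∪ R)ᶜ x)
    (hzw : w ∈ connectedComponentIn Kᶜ z) (hzw' : w ∉ connectedComponentIn (K ∪ R)ᶜ z) :
    x ∈ connectedComponentIn (K ∪ R)ᶜ z ∨ y ∈ connectedComponentIn (K ∪ R)ᶜ z := by
  classical
  subst hR
  have hRc := isCompact_range γ.continuous
  have hlogR : ∀ p q, p ∉ K ∪ range γ → q ∉ K ∪ range γ →
      HasLog (fun z => planeDiff p z / planeDiff q z) (range γ) := by
    intro p q hp hq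
    have h0 : ∀ p, p ∉ K ∪ range γ → ∀ z ∈ range γ, planeDiff p z ≠ 0 := fun p hp z hz =>
      planeDiff_ne_zero (by rintro rfl; exact hp (Or.inr hz))
    exact HasLog.of_arc γ hγi ((continuous_planeDiff p).continuousOn.div
      (continuous_planeDiff q).continuousOn (h0 q hq)) fun z hz => div_ne_zero (h0 p hp z hz)
        (h0 q hq z hz)
  have hlogK : ∀ p q, p ∉ K ∪ range γ → q ∉ K ∪ range γ → q ∈ connectedComponentIn Kᶜ p →
      HasLog (fun z => planeDiff p z / planeDiff q z) K := fun p q hp hq h =>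
    (hasLog_div_iff hK (fun h => hp (Or.inl h)) (fun h => hq (Or.inl h))).2 h
  obtain ⟨a, b, hab, ha⟩ := HasLog.exists_zpow_union hK.isClosed hRc.isClosed hKR
    (hlogK x y hx hy hxy) (hlogR x y hx hy) (hlogK z w hz hw hzw) (hlogR z w hz hw)
  by_contra! hcon
  refine hxy' ((hasLog_div_iff (hK.union hRc) hx hy).1 (ha ?_))
  have := sum_component_eq_zero_of_hasLog (Finset.univ : Finset (Fin 4)) ![x, y, z, w]
    ![b, -b, -a, a] (hK.union hRc) (by
      intro i _; fin_cases i <;> assumption) z (hab.congr fun t _ => by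
        simp [Fin.prod_univ_four, div_eq_mul_inv, mul_zpow]
        ring) (by
        simp [Fin.sum_univ_four])
  rw [Finset.sum_filter, Fin.sum_univ_four] at this
  simp only [Matrix.cons_val, hcon.1, hcon.2, hzw', mem_component_self hz, if_true,
    if_false] at this
  linarith

namespace PlaneEmbedding

variable {V : Type} {G : SimpleGraph V} (P : PlaneEmbedding G)

lemma exists_path (e : G.edgeSet) {u v : V} (h : (e : Sym2 V) = s(u, v)) :
    ∃ γ : Path (P.pos u) (P.pos v), Function.Injective γ ∧ range γ = P.arc e := by
  obtain ⟨u', v', h', γ, hγ, hr⟩ := P.arc_path e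
  rw [h, Sym2.eq_iff] at h'
  obtain ⟨rfl, rfl⟩ | ⟨rfl, rfl⟩ := h'
  · exact ⟨γ, hγ, hr⟩
  · refine ⟨γ.symm, ?_, by rw [Path.symm_range, hr]⟩
    intro s t hst
    simpa using hγ hst

lemma isCompact_arc (e : G.edgeSet) : IsCompact (P.arc e) := by
  obtain ⟨u, v, -, γ, -, hr⟩ := P.arc_path e
  exact hr ▸ isCompact_range γ.continuous

lemma dense_compl_arc (e : G.edgeSet) : Dense (P.arc e)ᶜ := by
  obtain ⟨u, v, -, γ, hγ, hr⟩ := P.arc_path e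
  exact hr ▸ dense_compl_range hγ

lemma pos_mem_arc {e : G.edgeSet} {u : V} (h : u ∈ (e : Sym2 V)) : P.pos u ∈ P.arc e := by
  obtain ⟨v, hv⟩ := Sym2.mem_iff_exists.1 h
  obtain ⟨γ, -, hr⟩ := P.exists_path e hv
  exact hr ▸ ⟨0, γ.source⟩

/-- The union of the arcs of a set of edges. -/
def drawing (S : Set G.edgeSet) : Set (ℝ × ℝ) := ⋃ e ∈ S, P.arc e

lemma mem_drawing {S : Set G.edgeSet} {x : ℝ × ℝ} :
    x ∈ P.drawing S ↔ ∃ e ∈ S, x ∈ P.arc e := by simp [drawing]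

lemma drawing_mono {S T : Set G.edgeSet} (h : S ⊆ T) : P.drawing S ⊆ P.drawing T :=
  biUnion_subset_biUnion_left h

lemma drawing_subset_image (S : Set G.edgeSet) : P.drawing S ⊆ P.image :=
  fun x hx => Or.inr <| by
    obtain ⟨e, -, h⟩ := P.mem_drawing.1 hx
    exact mem_iUnion.2 ⟨e, h⟩

lemma drawing_insert (e : G.edgeSet) (S : Set G.edgeSet) :
    P.drawing (insert e S) = P.drawing S ∪ P.arc e := by
  rw [drawing, biUnion_insert, union_comm, drawing]

lemma drawing_union (S T : Set G.edgeSet) :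
    P.drawing (S ∪ T) = P.drawing S ∪ P.drawing T := biUnion_union _ _ _

lemma pos_mem_drawing_iff {S : Set G.edgeSet} {v : V} :
    P.pos v ∈ P.drawing S ↔ ∃ e ∈ S, v ∈ (e : Sym2 V) := by
  rw [mem_drawing]
  exact exists_congr fun e => and_congr_right fun _ => ⟨P.arc_avoid e v, P.pos_mem_arc⟩

lemma drawing_inter_arc_subset {S : Set G.edgeSet} {e : G.edgeSet} (he : e ∉ S) {u v : V}
    (h : (e : Sym2 V) = s(u, v)) : P.drawing S ∩ P.arc e ⊆ {P.pos u, P.pos v} := by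
  rintro x ⟨hx, hxe⟩
  obtain ⟨f, hf, hxf⟩ := P.mem_drawing.1 hx
  obtain ⟨w, hw, -, rfl⟩ := P.arc_inter e f (by rintro rfl; exact he hf) x ⟨hxe, hxf⟩
  rw [h, Sym2.mem_iff] at hw
  obtain rfl | rfl := hw <;> simp

section
variable [Finite V]

lemma isCompact_drawing (S : Set G.edgeSet) : IsCompact (P.drawing S) :=
  (toFinite S).isCompact_biUnion fun e _ => P.isCompact_arc e

lemma dense_compl_image : Dense (P.image)ᶜ := by
  have h : (P.image)ᶜ = (⋂ v, {P.pos v}ᶜ) ∩ ⋂ e, (P.arc e)ᶜ := by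
    rw [image, compl_union, compl_iUnion, ← iUnion_singleton_eq_range, compl_iUnion]
  rw [h]
  exact (dense_iInter_of_isOpen (fun v => isOpen_compl_singleton)
    fun v => dense_compl_singleton _).inter_of_isOpen_right
    (dense_iInter_of_isOpen (fun e => (P.isCompact_arc e).isClosed.isOpen_compl)
      P.dense_compl_arc)
        (isOpen_iInter_of_finite fun e => (P.isCompact_arc e).isClosed.isOpen_compl)

end

/-- The points off the image of the embedding. -/
abbrev Off := {x : ℝ × ℝ // x ∉ P.image}

variable {P} in
lemma Off.notMem_drawing (x : P.Off) (S : Set G.edgeSet) : x.1 ∉ P.drawing S :=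
  fun h => x.2 (P.drawing_subset_image S h)

/-- Two points off the image are equivalent if the drawing of `S` does not separate them. -/
def region (S : Set G.edgeSet) : Setoid P.Off where
  r x y := y.1 ∈ connectedComponentIn (P.drawing S)ᶜ x.1
  iseqv := ⟨fun x => mem_component_self (x.notMem_drawing S),
    fun {x _} h => component_symm (x.notMem_drawing S) h,
    fun {x y z} h h' => by rwa [connectedComponentIn_eq h]⟩

variable {P}

lemma region_def {S : Set G.edgeSet} {x y : P.Off} :
    P.region S x y ↔ y.1 ∈ connectedComponentIn (P.drawing S)ᶜ x.1 := Iff.rfl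

lemma region_mono {S T : Set G.edgeSet} (h : S ⊆ T) : P.region T ≤ P.region S :=
  fun _ _ hxy => connectedComponentIn_mono _ (compl_subset_compl.2 (P.drawing_mono h)) hxy

lemma region_empty (x y : P.Off) : P.region ∅ x y := by
  simp [region_def, drawing, connectedComponentIn_univ]

lemma region_iff_hasLog [Finite V] {S : Set G.edgeSet} {x y : P.Off} :
    P.region S x y ↔ HasLog (fun z => planeDiff x z / planeDiff y z) (P.drawing S) :=
  (hasLog_div_iff (P.isCompact_drawing S) (x.notMem_drawing S) (y.notMem_drawing S)).symm

/-- The spanning subgraph with edge set `S`. -/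
def _root_.SimpleGraph.spanned (S : Set G.edgeSet) : SimpleGraph V :=
  SimpleGraph.fromEdgeSet (Subtype.val '' S)

lemma _root_.SimpleGraph.spanned_adj {S : Set G.edgeSet} {a b : V} :
    (SimpleGraph.spanned S).Adj a b ↔ ∃ e ∈ S, (e : Sym2 V) = s(a, b) := by
  simp only [SimpleGraph.spanned, SimpleGraph.fromEdgeSet_adj, mem_image]
  refine ⟨fun h => h.1, fun h => ⟨h, ?_⟩⟩
  obtain ⟨e, -, he⟩ := h
  have := e.2
  rw [he, SimpleGraph.mem_edgeSet] at this
  exact this.ne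

lemma _root_.SimpleGraph.spanned_mono {S T : Set G.edgeSet} (h : S ⊆ T) :
    SimpleGraph.spanned S ≤ SimpleGraph.spanned T :=
  SimpleGraph.fromEdgeSet_mono (image_mono h)

/-- The endpoints of `e` are not joined by the other edges of `S`. -/
def _root_.SimpleGraph.IsCutEdge (S : Set G.edgeSet) (e : G.edgeSet) : Prop :=
  ∃ u v, (e : Sym2 V) = s(u, v) ∧ ¬ (SimpleGraph.spanned (S \ {e})).Reachable u v

lemma _root_.SimpleGraph.isCutEdge_iff {S : Set G.edgeSet} {e : G.edgeSet} {u v : V}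
    (h : (e : Sym2 V) = s(u, v)) :
    SimpleGraph.IsCutEdge S e ↔ ¬ (SimpleGraph.spanned (S \ {e})).Reachable u v := by
  refine ⟨?_, fun h' => ⟨u, v, h, h'⟩⟩
  rintro ⟨a, b, hab, h'⟩
  rw [h, Sym2.eq_iff] at hab
  obtain ⟨rfl, rfl⟩ | ⟨rfl, rfl⟩ := hab
  · exact h'
  · exact fun h => h' h.symm

lemma hasLog_of_reachable {S : Set G.edgeSet} {u v : V} (huv : u ≠ v)
    (h : (SimpleGraph.spanned S).Reachable u v) :
    HasLog (fun z => planeDiff (P.pos u) z / planeDiff (P.pos v) z) (P.drawing S)ᶜ := by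
  obtain ⟨p⟩ := h
  induction p with
  | nil => exact absurd rfl huv
  | @cons u w v hadj p ih =>
    obtain ⟨e, he, hew⟩ := SimpleGraph.spanned_adj.1 hadj
    obtain ⟨γ, -, hr⟩ := P.exists_path e hew
    have h1 : HasLog (fun z => planeDiff (P.pos u) z / planeDiff (P.pos w) z) (P.drawing S)ᶜ := by
      refine (hasLog_compl_range γ).mono (compl_subset_compl.2 ?_)
      rw [hr]
      exact fun x hx => P.mem_drawing.2 ⟨e, he, hx⟩
    by_cases hwv : w = v
    · exact hwv ▸ h1
    · refine (h1.mul (ih hwv)).congr fun z hz => ?_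
      have : planeDiff (P.pos w) z ≠ 0 := planeDiff_ne_zero fun h => hz (by
        rw [h, pos_mem_drawing_iff]; exact ⟨e, he, by rw [hew]; simp⟩)
      field_simp

lemma drawing_diff_union {S : Set G.edgeSet} {e : G.edgeSet} (he : e ∈ S) :
    P.drawing (S \ {e}) ∪ P.arc e = P.drawing S := by
  rw [← drawing_insert, insert_sdiff_singleton, insert_eq_of_mem he]

/-- Adding an edge that closes a cycle separates two points. -/
theorem exists_region_diff [Finite V] {S : Set G.edgeSet} {e : G.edgeSet} (he : e ∈ S)
    (hb : ¬ SimpleGraph.IsCutEdge S e) :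
    ∃ x y, P.region (S \ {e}) x y ∧ ¬ P.region S x y := by
  obtain ⟨u, v, huv, -⟩ := P.arc_path e
  obtain ⟨γ, -, hr⟩ := P.exists_path e huv
  rw [SimpleGraph.isCutEdge_iff huv, not_not] at hb
  have hne : u ≠ v := by
    have := e.2
    rw [huv, SimpleGraph.mem_edgeSet] at this
    exact this.ne
  have hK := P.isCompact_drawing (S \ {e})
  obtain ⟨x, hx, y, hy, h1, h2⟩ := exists_separated_of_arc hK.isClosed (P.pos_inj.ne hne) γ
    (hr ▸ P.drawing_inter_arc_subset (by simp) huv) (hasLog_of_reachable hne hb)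
    P.dense_compl_image (by
      rw [hr, drawing_diff_union he]
      exact compl_subset_compl.2 (P.drawing_subset_image S))
  rw [hr, drawing_diff_union he] at h2
  exact ⟨⟨x, hx⟩, ⟨y, hy⟩, h1, h2⟩

/-- Removing an edge merges at most two regions. -/
theorem region_of_merged [Finite V] {S : Set G.edgeSet} {e : G.edgeSet} (he : e ∈ S)
    {x y z w : P.Off} (hxy : P.region (S \ {e}) x y) (hxy' : ¬ P.region S x y)
    (hzw : P.region (S \ {e}) z w) (hzw' : ¬ P.region S z w) :
    P.region S z x ∨ P.region S z y := by
  obtain ⟨u, v, huv, -⟩ := P.arc_path e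
  obtain ⟨γ, hγ, hr⟩ := P.exists_path e huv
  have h0 : ∀ x : P.Off, x.1 ∉ P.drawing (S \ {e}) ∪ P.arc e := fun x => by
    rw [drawing_diff_union he]; exact x.notMem_drawing S
  have := mem_component_of_separated (P.isCompact_drawing (S \ {e})) hγ hr
    (P.drawing_inter_arc_subset (by simp) huv) (h0 x) (h0 y) (h0 z) (h0 w) hxy
    (by rwa [drawing_diff_union he]) hzw (by rwa [drawing_diff_union he])
  rwa [drawing_diff_union he] at this

/-- A cut edge separates nothing. -/
theorem region_diff_of_isCutEdge [Finite V] {S : Set G.edgeSet} {e : G.edgeSet} (he : e ∈ S)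
    (hb : SimpleGraph.IsCutEdge S e) : P.region (S \ {e}) = P.region S := by
  refine le_antisymm (fun x y hxy => ?_) (region_mono sdiff_subset)
  obtain ⟨u, v, huv, -⟩ := P.arc_path e
  obtain ⟨γ, hγ, hr⟩ := P.exists_path e huv
  rw [SimpleGraph.isCutEdge_iff huv] at hb
  rw [region_iff_hasLog] at hxy ⊢
  let A : Set G.edgeSet :=
    {f ∈ S \ {e} | ∀ w ∈ (f : Sym2 V), (SimpleGraph.spanned (S \ {e})).Reachable u w}
  let B : Set G.edgeSet :=
    {f ∈ S \ {e} | ∀ w ∈ (f : Sym2 V), ¬ (SimpleGraph.spanned (S \ {e})).Reachable u w}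
  have hAB : S = (A ∪ {e}) ∪ B := by
    ext f
    by_cases hfe : f = e
    · subst hfe; simp [he]
    obtain ⟨a, b, hab, -⟩ := P.arc_path f
    simp only [A, B, mem_union, mem_ofPred_eq, mem_sdiff, mem_singleton_iff, hfe, not_false_eq_true,
      and_true, or_false, hab, Sym2.mem_iff, forall_eq_or_imp, forall_eq]
    refine ⟨fun hf => ?_, fun h => h.elim And.left And.left⟩
    have hadj : (SimpleGraph.spanned (S \ {e})).Adj a b :=
      SimpleGraph.spanned_adj.2 ⟨f, ⟨hf, hfe⟩, hab⟩
    by_cases ha : (SimpleGraph.spanned (S \ {e})).Reachable u a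
    · exact Or.inl ⟨hf, ha, ha.trans hadj.reachable⟩
    · exact Or.inr ⟨hf, ha, fun h => ha (h.trans hadj.symm.reachable)⟩
  have hlogR : HasLog (fun z => planeDiff x z / planeDiff y z) (P.arc e) := by
    have h0 : ∀ p : P.Off, ∀ z ∈ P.arc e, planeDiff p z ≠ 0 := fun p z hz =>
      planeDiff_ne_zero (by rintro rfl; exact p.notMem_drawing S (P.mem_drawing.2 ⟨e, he, hz⟩))
    rw [← hr] at h0 ⊢
    exact HasLog.of_arc γ hγ ((continuous_planeDiff x).continuousOn.div
      (continuous_planeDiff y).continuousOn (h0 y)) fun z hz => div_ne_zero (h0 x z hz)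
        (h0 y z hz)
  have hc : ∀ T, IsClosed (P.drawing T) := fun T => (P.isCompact_drawing T).isClosed
  have hA : HasLog (fun z => planeDiff x z / planeDiff y z) (P.drawing A ∪ P.arc e) := by
    refine HasLog.union_of_subsingleton (hc A) (P.isCompact_arc e).isClosed
      (hxy.mono (P.drawing_mono fun f hf => hf.1)) hlogR
      (subsingleton_singleton.anti (t := {P.pos u}) fun z hz => ?_)
    have := P.drawing_inter_arc_subset (fun h => h.1.2 rfl) huv hz
    obtain rfl | rfl := this
    · rfl
    · obtain ⟨f, hf, hvf⟩ := P.pos_mem_drawing_iff.1 hz.1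
      exact absurd (hf.2 v hvf) hb
  have : P.drawing S = (P.drawing A ∪ P.arc e) ∪ P.drawing B := by
    conv_lhs => rw [hAB, drawing_union, drawing_union]
    simp [drawing]
  rw [this]
  refine HasLog.union_of_subsingleton ((hc A).union (P.isCompact_arc e).isClosed) (hc B) hA
    (hxy.mono (P.drawing_mono fun f hf => hf.1))
    (subsingleton_singleton.anti (t := {P.pos v}) ?_)
  rintro z ⟨hz | hz, hzB⟩
  · obtain ⟨f, hf, hzf⟩ := P.mem_drawing.1 hz
    obtain ⟨g, hg, hzg⟩ := P.mem_drawing.1 hzB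
    have hfg : f ≠ g := by
      rintro rfl
      obtain ⟨a, b, hab, -⟩ := P.arc_path f
      have ha : a ∈ (f : Sym2 V) := by rw [hab]; simp
      exact hg.2 a ha (hf.2 a ha)
    obtain ⟨w, hwf, hwg, -⟩ := P.arc_inter f g hfg z ⟨hzf, hzg⟩
    exact absurd (hf.2 w hwf) (hg.2 w hwg)
  · obtain rfl | rfl := P.drawing_inter_arc_subset (fun h => h.1.2 rfl) huv ⟨hzB, hz⟩
    · obtain ⟨f, hf, hvf⟩ := P.pos_mem_drawing_iff.1 hzB
      exact absurd (SimpleGraph.Reachable.refl u) (hf.2 u hvf)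
    · rfl

end PlaneEmbedding

section Setoid
variable {α : Type*} {s t : Setoid α}

lemma Setoid.card_quotient_le_add_one (hst : s ≤ t)
    (h : ∀ x y z w, t x y → ¬ s x y → t z w → ¬ s z w → s z x ∨ s z y) [Finite (Quotient t)] :
    Finite (Quotient s) ∧ Nat.card (Quotient s) ≤ Nat.card (Quotient t) + 1 := by
  classical
  obtain ⟨φ, hφ⟩ : ∃ φ : Quotient s → Option (Quotient t), Function.Injective φ := by
    let m : Quotient s → Quotient t := Quotient.map' id fun _ _ hab => hst hab
    by_cases hbad : ∃ x y, t x y ∧ ¬ s x y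
    · obtain ⟨x, y, hxy, hxy'⟩ := hbad
      refine ⟨fun q => if q = Quotient.mk s y then none else some (m q), fun q₁ q₂ => ?_⟩
      induction q₁ using Quotient.inductionOn with | _ z
      induction q₂ using Quotient.inductionOn with | _ w
      intro heq
      beta_reduce at heq
      split_ifs at heq with h1 h2 h2
      · rw [h1, h2]
      · have hzw : t z w := Quotient.exact (Option.some.inj heq)
        by_contra hne
        have hzw' : ¬ s z w := fun h => hne (Quotient.sound h)
        have hz := (h x y z w hxy hxy' hzw hzw').resolve_right fun h => h1 (Quotient.sound h)
        have hw := (h x y w z hxy hxy' (t.symm' hzw) fun h => hzw' (s.symm' h)).resolve_right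
          fun h => h2 (Quotient.sound h)
        exact hzw' (s.trans' hz (s.symm' hw))
    · push Not at hbad
      refine ⟨fun q => some (m q), fun q₁ q₂ => ?_⟩
      induction q₁ using Quotient.inductionOn with | _ z
      induction q₂ using Quotient.inductionOn with | _ w
      exact fun heq => Quotient.sound (hbad _ _ (Quotient.exact (Option.some.inj heq)))
  refine ⟨Finite.of_injective φ hφ, ?_⟩
  rw [← Finite.card_option]
  exact Nat.card_le_card_of_injective φ hφ

lemma Setoid.card_quotient_add_one_le (hst : s ≤ t) {x y : α} (hxy : t x y) (hxy' : ¬ s x y)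
    [Finite (Quotient s)] : Nat.card (Quotient t) + 1 ≤ Nat.card (Quotient s) := by
  let m : Quotient s → Quotient t := Quotient.map' id fun _ _ hab => hst hab
  have hm : Function.Surjective m := fun q => by
    induction q using Quotient.inductionOn with | _ z
    exact ⟨Quotient.mk s z, rfl⟩
  have := Finite.of_surjective m hm
  refine Nat.lt_of_le_of_ne (Nat.card_le_card_of_surjective m hm) fun heq => hxy' ?_
  have hinj := (Function.Surjective.bijective_of_nat_card_le hm heq.ge).1
  exact Quotient.exact (hinj (a₁ := Quotient.mk s x) (a₂ := Quotient.mk s y)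
    (Quotient.sound hxy))

end Setoid

namespace SimpleGraph

variable {V : Type} {G : SimpleGraph V} {S : Set G.edgeSet} {e : G.edgeSet} {u v : V}

lemma reachable_spanned_insert (h : (e : Sym2 V) = s(u, v)) {a b : V}
    (hab : (spanned (insert e S)).Reachable a b) : (spanned S).Reachable a b ∨
      ((spanned S).Reachable a u ∧ (spanned S).Reachable v b) ∨
      ((spanned S).Reachable a v ∧ (spanned S).Reachable u b) := by
  obtain ⟨p⟩ := hab
  induction p with
  | nil => exact Or.inl (Reachable.refl _)
  | @cons a w b hadj p ih =>
    obtain ⟨f, hf | hf, hfw⟩ := spanned_adj.1 hadj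
    · rw [hf, h, Sym2.eq_iff] at hfw
      obtain ⟨rfl, rfl⟩ | ⟨rfl, rfl⟩ := hfw
      · obtain h1 | ⟨h1, h2⟩ | ⟨h1, h2⟩ := ih
        · exact Or.inr (Or.inl ⟨Reachable.refl _, h1⟩)
        · exact Or.inr (Or.inl ⟨Reachable.refl _, h2⟩)
        · exact Or.inl h2
      · obtain h1 | ⟨h1, h2⟩ | ⟨h1, h2⟩ := ih
        · exact Or.inr (Or.inr ⟨Reachable.refl _, h1⟩)
        · exact Or.inl h2
        · exact Or.inr (Or.inr ⟨Reachable.refl _, h2⟩)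
    · have h0 : (spanned S).Reachable a w := (spanned_adj.2 ⟨f, hf, hfw⟩).reachable
      exact ih.imp h0.trans (Or.imp (And.imp_left h0.trans) (And.imp_left h0.trans))

lemma card_connectedComponent_spanned_le [Finite V] (S : Set G.edgeSet) (e : G.edgeSet) :
    Nat.card (spanned S).ConnectedComponent ≤
      Nat.card (spanned (insert e S)).ConnectedComponent + 1 := by
  obtain ⟨u, v, h⟩ : ∃ u v, (e : Sym2 V) = s(u, v) := Sym2.ind (fun u v => ⟨u, v, rfl⟩) e.1
  refine (Setoid.card_quotient_le_add_one (s := (spanned S).reachableSetoid)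
    (t := (spanned (insert e S)).reachableSetoid)
    (fun a b hab => Reachable.mono (spanned_mono (subset_insert _ _)) hab) ?_).2
  intro x y z w hxy hxy' hzw hzw'
  obtain h1 | ⟨h1, h2⟩ | ⟨h1, h2⟩ := reachable_spanned_insert h hxy
  · exact absurd h1 hxy'
  all_goals
    obtain h3 | ⟨h3, h4⟩ | ⟨h3, h4⟩ := reachable_spanned_insert h hzw
    · exact absurd h3 hzw'
  · exact Or.inl (h3.trans h1.symm)
  · exact Or.inr (h3.trans h2)
  · exact Or.inr (h3.trans h2)
  · exact Or.inl (h3.trans h1.symm)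

lemma card_connectedComponent_spanned_insert (he : e ∉ S) (hb : ¬ IsCutEdge (insert e S) e) :
    Nat.card (spanned (insert e S)).ConnectedComponent =
      Nat.card (spanned S).ConnectedComponent := by
  obtain ⟨u, v, h⟩ : ∃ u v, (e : Sym2 V) = s(u, v) := Sym2.ind (fun u v => ⟨u, v, rfl⟩) e.1
  rw [isCutEdge_iff h, not_not, insert_sdiff_self_of_notMem he] at hb
  refine Nat.card_congr (Quotient.congrRight (r := (spanned (insert e S)).reachableSetoid)
    (r' := (spanned S).reachableSetoid) fun a b => ⟨fun hab => ?_,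
      fun hab => Reachable.mono (spanned_mono (subset_insert _ _)) hab⟩)
  obtain h1 | ⟨h1, h2⟩ | ⟨h1, h2⟩ := reachable_spanned_insert h hab
  · exact h1
  · exact h1.trans (hb.trans h2)
  · exact h1.trans (hb.symm.trans h2)

lemma eq_of_reachable_spanned (hu : ∀ e ∈ S, u ∉ (e : Sym2 V))
    (h : (spanned S).Reachable u v) : u = v := by
  obtain ⟨p⟩ := h
  cases p with
  | nil => rfl
  | cons hadj p =>
    obtain ⟨f, hf, hfw⟩ := spanned_adj.1 hadj
    exact absurd (by rw [hfw]; simp) (hu f hf)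

lemma isCutEdge_of_isolated (hu : ∀ f ∈ S \ {e}, u ∉ (f : Sym2 V)) (he : u ∈ (e : Sym2 V)) :
    IsCutEdge S e := by
  obtain ⟨v, hv⟩ := Sym2.mem_iff_exists.1 he
  refine ⟨u, v, hv, fun h => ?_⟩
  have := e.2
  rw [hv, mem_edgeSet] at this
  exact this.ne (eq_of_reachable_spanned hu h)

lemma IsCutEdge.mono {T : Set G.edgeSet} (hST : S ⊆ T) (h : IsCutEdge T e) : IsCutEdge S e :=
  let ⟨u, v, huv, h'⟩ := h
  ⟨u, v, huv, fun hr => h' (hr.mono (spanned_mono (sdiff_subset_sdiff_left hST)))⟩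

lemma card_add_one_le_card_connectedComponent [Finite V] {U : Set V} (hU : U.Nonempty)
    (hS : ∀ e ∈ S, ∀ v ∈ (e : Sym2 V), v ∈ U) :
    Nat.card V + 1 ≤ Nat.card (spanned S).ConnectedComponent + U.ncard := by
  classical
  obtain ⟨u, hu⟩ := hU
  let φ : Option (Uᶜ : Set V) → (spanned S).ConnectedComponent := fun o =>
    (spanned S).connectedComponentMk (o.elim u (↑))
  have hiso : ∀ v : (Uᶜ : Set V), ∀ e ∈ S, v.1 ∉ (e : Sym2 V) := fun v e he hv =>
    v.2 (hS e he v hv)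
  have hφ : Function.Injective φ := by
    rintro (_ | v) (_ | w) h
    · rfl
    · have := eq_of_reachable_spanned (hiso w) (ConnectedComponent.exact h).symm
      exact absurd (this ▸ hu) w.2
    · have := eq_of_reachable_spanned (hiso v) (ConnectedComponent.exact h)
      exact absurd (this ▸ hu) v.2
    · have := eq_of_reachable_spanned (hiso v) (ConnectedComponent.exact h)
      exact congr_arg some (Subtype.ext this)
  have := Finite.of_surjective (spanned S).connectedComponentMk Quot.mk_surjective
  have h1 := Nat.card_le_card_of_injective φ hφ
  rw [Finite.card_option, Nat.card_coe_set_eq] at h1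
  have h2 := ncard_add_ncard_compl U
  omega

end SimpleGraph

namespace PlaneEmbedding

variable {V : Type} [Finite V] {G : SimpleGraph V} {P : PlaneEmbedding G} {S : Set G.edgeSet}
  {e : G.edgeSet}

lemma card_region_insert_le (S : Set G.edgeSet) (e : G.edgeSet)
    [Finite (Quotient (P.region S))] : Finite (Quotient (P.region (insert e S))) ∧
      Nat.card (Quotient (P.region (insert e S))) ≤ Nat.card (Quotient (P.region S)) + 1 := by
  by_cases he : e ∈ S
  · rw [insert_eq_of_mem he]; exact ⟨inferInstance, by omega⟩
  refine Setoid.card_quotient_le_add_one (region_mono (subset_insert e S)) ?_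
  intro x y z w hxy hxy' hzw hzw'
  have h : insert e S \ {e} = S := insert_sdiff_self_of_notMem he
  exact region_of_merged (mem_insert e S) (by rwa [h]) hxy' (by rwa [h]) hzw'

lemma region_insert_of_isCutEdge (hb : SimpleGraph.IsCutEdge (insert e S) e) :
    P.region (insert e S) = P.region S := by
  by_cases he : e ∈ S
  · rw [insert_eq_of_mem he]
  rw [← region_diff_of_isCutEdge (mem_insert e S) hb, insert_sdiff_self_of_notMem he]

lemma region_insert_of_isolated {u : V} (hu : ∀ f ∈ S, u ∉ (f : Sym2 V)) (he : u ∈ (e : Sym2 V)) :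
    P.region (insert e S) = P.region S :=
  region_insert_of_isCutEdge (SimpleGraph.isCutEdge_of_isolated
    (fun f hf => hu f (hf.1.resolve_left hf.2)) he)

variable (P) in
lemma card_region_empty : Nat.card (Quotient (P.region ∅)) = 1 := by
  have : Subsingleton (Quotient (P.region ∅)) := ⟨fun a b => by
    induction a using Quotient.inductionOn with | _ x
    induction b using Quotient.inductionOn with | _ y
    exact Quotient.sound (region_empty x y)⟩
  obtain ⟨x, hx⟩ := P.dense_compl_image.nonempty
  have : Nonempty (Quotient (P.region ∅)) := ⟨Quotient.mk _ ⟨x, hx⟩⟩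
  exact Nat.card_unique

instance finite_region (S : Set G.edgeSet) : Finite (Quotient (P.region S)) := by
  induction S, toFinite S using Set.Finite.induction_on with
  | empty => exact Nat.finite_of_card_ne_zero (by rw [card_region_empty]; exact one_ne_zero)
  | insert _ _ ih => exact (card_region_insert_le _ _).1

/-- The Euler inequality for a set of edges of a plane graph. -/
theorem ncard_add_card_le_card_region_add (S : Set G.edgeSet) :
    S.ncard + Nat.card (SimpleGraph.spanned S).ConnectedComponent + 1 ≤
      Nat.card (Quotient (P.region S)) + Nat.card V := by
  induction S, toFinite S using Set.Finite.induction_on with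
  | empty =>
    rw [card_region_empty, ncard_empty]
    have := Nat.card_le_card_of_surjective
      (SimpleGraph.spanned (∅ : Set G.edgeSet)).connectedComponentMk Quot.mk_surjective
    omega
  | @insert e S he hS ih =>
    rw [ncard_insert_of_notMem he hS]
    by_cases hb : SimpleGraph.IsCutEdge (insert e S) e
    · have := SimpleGraph.card_connectedComponent_spanned_le S e
      rw [region_insert_of_isCutEdge hb]
      obtain ⟨u, v, h⟩ : ∃ u v, (e : Sym2 V) = s(u, v) := Sym2.ind (fun u v => ⟨u, v, rfl⟩) e.1
      have h3 : Nat.card (SimpleGraph.spanned (insert e S)).ConnectedComponent + 1 ≤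
          Nat.card (SimpleGraph.spanned S).ConnectedComponent := by
        have := Finite.of_surjective (SimpleGraph.spanned S).connectedComponentMk Quot.mk_surjective
        refine Setoid.card_quotient_add_one_le (s := (SimpleGraph.spanned S).reachableSetoid)
          (t := (SimpleGraph.spanned (insert e S)).reachableSetoid)
          (fun a b hab => SimpleGraph.Reachable.mono
            (SimpleGraph.spanned_mono (subset_insert _ _)) hab) (x := u) (y := v)
          (SimpleGraph.Adj.reachable (SimpleGraph.spanned_adj.2 ⟨e, mem_insert _ _, h⟩)) ?_
        rw [SimpleGraph.isCutEdge_iff h, insert_sdiff_self_of_notMem he] at hb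
        exact hb
      omega
    · rw [SimpleGraph.card_connectedComponent_spanned_insert he hb]
      obtain ⟨x, y, h1, h2⟩ := exists_region_diff (P := P) (mem_insert e S) hb
      rw [insert_sdiff_self_of_notMem he] at h1
      have := Setoid.card_quotient_add_one_le (region_mono (subset_insert e S)) h1 h2
      omega

theorem ncard_add_two_le_card_region_add {U : Set V} (hU : U.Nonempty)
    (hS : ∀ e ∈ S, ∀ v ∈ (e : Sym2 V), v ∈ U) :
    S.ncard + 2 ≤ Nat.card (Quotient (P.region S)) + U.ncard := by
  have h1 := ncard_add_card_le_card_region_add (P := P) S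
  have h2 := SimpleGraph.card_add_one_le_card_connectedComponent hU hS
  omega

end PlaneEmbedding

namespace PlaneEmbedding

variable {V : Type} [Finite V] {G : SimpleGraph V} {P : PlaneEmbedding G} {S T : Set G.edgeSet}
  {e : G.edgeSet}

/-- The edges of `S` whose removal merges the region of `x` with another one. -/
def bdry (P : PlaneEmbedding G) (S : Set G.edgeSet) (x : P.Off) : Set G.edgeSet :=
  {e ∈ S | ∃ y, P.region (S \ {e}) x y ∧ ¬ P.region S x y}

omit [Finite V] in
lemma bdry_subset (x : P.Off) : P.bdry S x ⊆ S := fun _ h => h.1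

/-- Every edge is on the boundary of at most two regions. -/
theorem sum_ncard_bdry_le (S : Set G.edgeSet) [Fintype (Quotient (P.region S))] :
    ∑ f : Quotient (P.region S), (P.bdry S f.out).ncard ≤ 2 * S.ncard := by
  classical
  have hS := toFinite S
  have := hS.fintype
  have h1 : ∀ f : Quotient (P.region S), (P.bdry S f.out).ncard =
      (Finset.bipartiteAbove (fun f e => e ∈ P.bdry S f.out) S.toFinset f).card := fun f => by
    rw [← ncard_coe_finset]
    congr 1
    ext e
    simpa [Finset.bipartiteAbove] using fun h => bdry_subset _ h
  rw [Finset.sum_congr rfl fun f _ => h1 f,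
    Finset.sum_card_bipartiteAbove_eq_sum_card_bipartiteBelow, ncard_eq_toFinset_card',
    mul_comm, ← smul_eq_mul]
  refine Finset.sum_le_card_nsmul _ _ _ fun e he => ?_
  rw [mem_toFinset] at he
  by_contra! h
  obtain ⟨a, ha, b, hb, c, hc, hab, hac, hbc⟩ := Finset.two_lt_card.1 h
  simp only [Finset.bipartiteBelow, Finset.mem_filter, Finset.mem_univ, true_and] at ha hb hc
  have key : ∀ {f g : Quotient (P.region S)}, f ≠ g → ¬ P.region S f.out g.out := fun {f g} hfg h =>
    hfg (by rw [← f.out_eq, ← g.out_eq]; exact Quotient.sound h)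
  obtain ⟨x, hx, hx'⟩ := ha.2
  obtain ⟨y, hy, hy'⟩ := hb.2
  obtain ⟨z, hz, hz'⟩ := hc.2
  have h1 := (region_of_merged he hx hx' hy hy').resolve_left (key hab.symm)
  have h2 := (region_of_merged he hx hx' hz hz').resolve_left (key hac.symm)
  exact key hbc ((P.region S).trans' h1 ((P.region S).symm' h2))

omit [Finite V] in
lemma isPreconnected_arc_diff {u v : V} (h : (e : Sym2 V) = s(u, v)) :
    IsPreconnected (P.arc e \ {P.pos u, P.pos v}) := by
  obtain ⟨γ, hγ, hr⟩ := P.exists_path e h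
  have : P.arc e \ {P.pos u, P.pos v} = γ '' Ioo 0 1 := by
    have hI : Ioo (0 : unitInterval) 1 = {0, 1}ᶜ := by
      ext t
      simp [unitInterval.pos_iff_ne_zero, unitInterval.lt_one_iff_ne_one]
    rw [hI, image_compl_eq_range_sdiff_image hγ, hr, image_pair, γ.source, γ.target]
  rw [this]
  exact isPreconnected_Ioo.image _ γ.continuous.continuousOn

omit [Finite V] in
/-- The relative interior of an arc is connected, so lies in one component. -/
lemma arc_diff_subset_component {K : Set (ℝ × ℝ)} {u v : V} (h : (e : Sym2 V) = s(u, v))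
    (hK : K ∩ P.arc e ⊆ {P.pos u, P.pos v}) {x p : ℝ × ℝ} (hp : p ∈ P.arc e)
    (hpu : p ∉ ({P.pos u, P.pos v} : Set (ℝ × ℝ))) (hpx : p ∈ connectedComponentIn Kᶜ x) :
    P.arc e \ {P.pos u, P.pos v} ⊆ connectedComponentIn Kᶜ x := by
  rw [connectedComponentIn_eq hpx]
  exact (isPreconnected_arc_diff h).subset_connectedComponentIn ⟨hp, hpu⟩
    fun z hz hzK => hz.2 (hK ⟨hzK, hz.1⟩)

/-- An edge of a cycle that is not on the boundary of a region stays away from it. -/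
theorem disjoint_component_arc (he : e ∈ S) (hb : ¬ SimpleGraph.IsCutEdge S e) {x : P.Off}
    (hx : e ∉ P.bdry S x) :
    Disjoint (connectedComponentIn (P.drawing (S \ {e}))ᶜ x.1) (P.arc e) := by
  rw [Set.disjoint_left]
  intro p hpx hpe
  obtain ⟨u, v, huv, -⟩ := P.arc_path e
  have hne : u ≠ v := by
    have := e.2
    rw [huv, SimpleGraph.mem_edgeSet] at this
    exact this.ne
  have hends : ({P.pos u, P.pos v} : Set (ℝ × ℝ)) ⊆ P.drawing (S \ {e}) := by
    rw [SimpleGraph.isCutEdge_iff huv, not_not] at hb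
    rintro _ (rfl | rfl)
    all_goals
      rw [pos_mem_drawing_iff]
      by_contra! hcon
    · exact hne (SimpleGraph.eq_of_reachable_spanned hcon hb)
    · exact hne (SimpleGraph.eq_of_reachable_spanned hcon hb.symm).symm
  have hK := P.drawing_inter_arc_subset (S := S \ {e}) (fun h => h.2 rfl) huv
  have hp : ∀ {y q}, q ∈ connectedComponentIn (P.drawing (S \ {e}))ᶜ y →
      q ∉ ({P.pos u, P.pos v} : Set (ℝ × ℝ)) := fun hq hq' =>
    notMem_of_mem_component hq (hends hq')
  obtain ⟨z, w, hzw, hzw'⟩ := exists_region_diff he hb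
  have key : ∀ z w : P.Off, P.region (S \ {e}) z w → ¬ P.region S z w →
      P.region (S \ {e}) x z := by
    intro z w hzw hzw'
    by_contra hxz
    refine hzw' ?_
    have hdisj : connectedComponentIn (P.drawing (S \ {e}))ᶜ z.1 ⊆ (P.drawing S)ᶜ := by
      rw [← drawing_diff_union he]
      rintro q hq (hq' | hq')
      · exact notMem_of_mem_component hq hq'
      · have := arc_diff_subset_component huv hK hq' (hp hq) hq ⟨hpe, hp hpx⟩
        refine hxz ?_
        rw [region_def, connectedComponentIn_eq hpx]
        exact component_symm (z.notMem_drawing _) this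
    exact isPreconnected_connectedComponentIn.subset_connectedComponentIn
      (mem_component_self (z.notMem_drawing _)) hdisj hzw
  have hz := key z w hzw hzw'
  have hw := key w z ((P.region _).symm' hzw) fun h => hzw' ((P.region S).symm' h)
  have hmem : ∀ {y}, P.region (S \ {e}) x y → P.region S x y := fun h => by
    by_contra h'
    exact hx ⟨he, _, h, h'⟩
  exact hzw' ((P.region S).trans' ((P.region S).symm' (hmem hz)) (hmem hw))

lemma hasLog_union_pos {f : ℝ × ℝ → ℂ} {K : Set (ℝ × ℝ)} (hK : IsClosed K) (hf : HasLog f K)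
    (T : Set V) (h0 : ∀ v ∈ T, f (P.pos v) ≠ 0) : HasLog f (K ∪ P.pos '' T) := by
  induction T, toFinite T using Set.Finite.induction_on with
  | empty => simpa using hf
  | @insert v T _ _ ih =>
    rw [image_insert_eq, insert_eq, union_comm {P.pos v}, ← union_assoc]
    exact (ih fun w hw => h0 w (mem_insert_of_mem v hw)).union_of_subsingleton
      (hK.union ((toFinite T).image _).isClosed) isClosed_singleton
      (HasLog.of_finite (finite_singleton _) (by rintro _ rfl; exact h0 v (mem_insert _ _)))
      (subsingleton_singleton.anti inter_subset_right)

/-- A region is determined by its boundary edges, together with the cut edges. -/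
theorem region_of_region_bdry_union {x y : P.Off}
    (h : P.region (P.bdry S x ∪ {e ∈ S | SimpleGraph.IsCutEdge S e}) x y) : P.region S x y := by
  set D := P.bdry S x ∪ {e ∈ S | SimpleGraph.IsCutEdge S e}
  have hpos : ∀ (z : P.Off) v, P.pos v ≠ z.1 := fun z v h => z.2 (Or.inl ⟨v, h⟩)
  have hD := P.isCompact_drawing D
  have hxK : ∀ z : P.Off, z.1 ∉ P.drawing D ∪ P.pos '' univ := by
    rintro z (hz | ⟨v, -, hz⟩)
    · exact z.notMem_drawing D hz
    · exact hpos z v hz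
  have hy : y.1 ∈ connectedComponentIn (P.drawing D ∪ P.pos '' univ)ᶜ x.1 := by
    rw [← hasLog_div_iff (hD.union ((toFinite univ).image _).isCompact) (hxK x) (hxK y)]
    exact hasLog_union_pos hD.isClosed (region_iff_hasLog.1 h) _ fun v _ =>
      div_ne_zero (planeDiff_ne_zero (hpos x v)) (planeDiff_ne_zero (hpos y v))
  refine isPreconnected_connectedComponentIn.subset_of_closure_inter_subset
    (isOpen_component (P.isCompact_drawing S).isClosed x.1)
    ⟨x.1, mem_component_self (hxK x), mem_component_self (x.notMem_drawing S)⟩ ?_ hy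
  rintro p ⟨hpW, hpC⟩
  by_contra hp
  have hpK := notMem_of_mem_component hpC
  have hpS := frontier_component_subset (P.isCompact_drawing S).isClosed x.1
    ⟨hpW, fun h => hp (interior_subset h)⟩
  obtain ⟨e, he, hpe⟩ := P.mem_drawing.1 hpS
  have heD : e ∉ D := fun h => hpK (Or.inl (P.mem_drawing.2 ⟨e, h, hpe⟩))
  have hdisj := disjoint_component_arc he (fun h => heD (Or.inr ⟨he, h⟩))
    (fun h => heD (Or.inl h))
  refine Set.disjoint_left.1 hdisj ?_ hpe
  by_contra hp'
  have hpcl := closure_mono (connectedComponentIn_mono x.1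
    (compl_subset_compl.2 (P.drawing_mono (sdiff_subset (s := S) (t := {e}))))) hpW
  have hpS' := frontier_component_subset (P.isCompact_drawing (S \ {e})).isClosed x.1
    ⟨hpcl, fun h => hp' (interior_subset h)⟩
  obtain ⟨f, hf, hpf⟩ := P.mem_drawing.1 hpS'
  obtain ⟨w, -, -, rfl⟩ := P.arc_inter e f (fun h => hf.2 h.symm) p ⟨hpe, hpf⟩
  exact hpK (Or.inr ⟨w, mem_univ _, rfl⟩)

lemma region_union_of_isCutEdge {B C : Set G.edgeSet} (hB : B ⊆ T) (hC : C ⊆ T)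
    (h : ∀ e ∈ C, SimpleGraph.IsCutEdge T e) : P.region (B ∪ C) = P.region B := by
  induction C, toFinite C using Set.Finite.induction_on with
  | empty => rw [union_empty]
  | @insert c C _ _ ih =>
    rw [← ih ((subset_insert _ _).trans hC) fun e he => h e (mem_insert_of_mem _ he),
      union_insert]
    refine region_insert_of_isCutEdge ((h c (mem_insert _ _)).mono ?_)
    rw [← union_insert]
    exact union_subset hB hC

/-- A region is determined by its boundary edges. -/
theorem region_of_region_bdry {x y : P.Off} (h : P.region (P.bdry S x) x y) :
    P.region S x y := by
  refine region_of_region_bdry_union ?_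
  rwa [region_union_of_isCutEdge (T := S) (bdry_subset x) (fun _ h => h.1) fun _ h => h.2]

lemma not_isCutEdge_of_mem_bdry {x : P.Off} (he : e ∈ P.bdry S x) :
    ¬ SimpleGraph.IsCutEdge (P.bdry S x) e := by
  intro hb
  obtain ⟨y, hy, hy'⟩ := he.2
  refine hy' (region_of_region_bdry ?_)
  rw [← region_diff_of_isCutEdge he hb]
  exact region_mono (sdiff_subset_sdiff_left (bdry_subset x)) hy

/-- No vertex has degree one on the boundary of a region. -/
lemma exists_ne_mem_bdry {x : P.Off} (he : e ∈ P.bdry S x) {u : V} (hu : u ∈ (e : Sym2 V)) :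
    ∃ f ∈ P.bdry S x, f ≠ e ∧ u ∈ (f : Sym2 V) := by
  by_contra! h
  exact not_isCutEdge_of_mem_bdry he
    (SimpleGraph.isCutEdge_of_isolated (fun f hf => h f hf.1 hf.2) hu)

lemma bdry_nonempty {x y : P.Off} (h : ¬ P.region S x y) : (P.bdry S x).Nonempty := by
  rw [nonempty_iff_ne_empty]
  intro h0
  exact h (region_of_region_bdry (by rw [h0]; exact region_empty x y))

/-- Distinct regions lie in disjoint components of the complements of their boundaries. -/
theorem disjoint_component_bdry {x x' : P.Off} (h : ¬ P.region S x x') :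
    Disjoint (connectedComponentIn (P.drawing (P.bdry S x))ᶜ x.1)
      (connectedComponentIn (P.drawing (P.bdry S x'))ᶜ x'.1) := by
  rw [Set.disjoint_iff_inter_eq_empty]
  by_contra hne
  obtain ⟨z, ⟨hz, hz'⟩, hzO⟩ := P.dense_compl_image.inter_open_nonempty _
    ((isOpen_component (P.isCompact_drawing _).isClosed _).inter
      (isOpen_component (P.isCompact_drawing _).isClosed _)) (nonempty_iff_ne_empty.2 hne)
  have h1 : P.region S x ⟨z, hzO⟩ := region_of_region_bdry hz
  have h2 : P.region S x' ⟨z, hzO⟩ := region_of_region_bdry hz'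
  exact h ((P.region S).trans' h1 ((P.region S).symm' h2))

end PlaneEmbedding

namespace SimpleGraph

variable {V : Type} {G : SimpleGraph V} {J : Set V} {u v w a b : V}

/-- The edges incident to a vertex of `J`. -/
def star (G : SimpleGraph V) (J : Set V) : Set G.edgeSet := {e | ∃ v ∈ J, v ∈ (e : Sym2 V)}

lemma mem_star {e : G.edgeSet} : e ∈ G.star J ↔ ∃ v ∈ J, v ∈ (e : Sym2 V) := Iff.rfl

lemma star_mono {K : Set V} (h : J ⊆ K) : G.star J ⊆ G.star K :=
  fun _ ⟨v, hv, he⟩ => ⟨v, h hv, he⟩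

lemma star_insert : G.star (insert v J) = G.star {v} ∪ G.star J := by
  ext e
  simp [mem_star]

lemma exists_eq_of_mem_edge {e : G.edgeSet} (h : v ∈ (e : Sym2 V)) :
    ∃ w, G.Adj v w ∧ (e : Sym2 V) = s(v, w) := by
  obtain ⟨w, hw⟩ := Sym2.mem_iff_exists.1 h
  have := e.2
  rw [hw, mem_edgeSet] at this
  exact ⟨w, this, hw⟩

lemma ncard_star_singleton [Finite V] (v : V) :
    (G.star {v}).ncard = (G.neighborSet v).ncard := by
  refine (ncard_congr (fun w hw => (⟨s(v, w), hw⟩ : G.edgeSet)) ?_ ?_ ?_).symm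
  · intro w hw
    exact ⟨v, rfl, by simp⟩
  · intro w w' hw hw' h
    rcases Sym2.eq_iff.1 (Subtype.ext_iff.1 h) with h | h
    · exact h.2
    · exact h.2.trans h.1
  · rintro e ⟨_, rfl, he⟩
    obtain ⟨w, hw, h⟩ := exists_eq_of_mem_edge he
    exact ⟨w, hw, Subtype.ext h.symm⟩

lemma ncard_star [Finite V] (J : Finset V) (hJ : G.IsIndepSet (J : Set V)) :
    (G.star (J : Set V)).ncard = ∑ v ∈ J, (G.neighborSet v).ncard := by
  classical
  induction J using Finset.induction_on with
  | empty => simp [star]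
  | @insert v J hv ih =>
    rw [Finset.coe_insert] at hJ ⊢
    rw [star_insert, ncard_union_eq, ncard_star_singleton, Finset.sum_insert hv,
      ih (hJ.mono (subset_insert _ _))]
    rw [Set.disjoint_left]
    rintro e ⟨u, hu, h⟩ ⟨w, hw, h'⟩
    rw [mem_singleton_iff.1 hu] at h
    have hne := ne_of_mem_of_not_mem hw hv
    have : (e : Sym2 V) = s(w, v) := ((Sym2.mem_and_mem_iff hne).1 ⟨h', h⟩)
    have he := e.2
    rw [this, mem_edgeSet] at he
    exact hJ (mem_insert_of_mem _ hw) (mem_insert _ _) hne he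

end SimpleGraph

namespace PlaneEmbedding

open SimpleGraph (mem_star star_insert exists_eq_of_mem_edge)

variable {V : Type} [Finite V] {G : SimpleGraph V} {P : PlaneEmbedding G} {J R : Set V}
  {a b v w : V}

/-- The boundary of a region of a bipartite graph passes twice through two vertices on a side. -/
theorem exists_mem_bdry_star (hJ : G.IsIndepSet J) {x : P.Off}
    (hne : (P.bdry (G.star J) x).Nonempty) :
    ∃ v ∈ J, ∃ w ∈ J, v ≠ w ∧ ∃ a b c : V, a ≠ b ∧ a ≠ c ∧ ∃ e f g h : G.edgeSet,
      (e : Sym2 V) = s(v, a) ∧ (f : Sym2 V) = s(v, b) ∧ (g : Sym2 V) = s(w, a) ∧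
      (h : Sym2 V) = s(w, c) ∧ e ∈ P.bdry (G.star J) x ∧ f ∈ P.bdry (G.star J) x ∧
      g ∈ P.bdry (G.star J) x ∧ h ∈ P.bdry (G.star J) x := by
  obtain ⟨e, he⟩ := hne
  obtain ⟨v, hv, hve⟩ := bdry_subset x he
  obtain ⟨a, hva, hea⟩ := exists_eq_of_mem_edge hve
  have ha : a ∉ J := fun h => hJ hv h hva.ne hva
  obtain ⟨f, hf, hfe, hvf⟩ := exists_ne_mem_bdry he hve
  obtain ⟨b, -, hfb⟩ := exists_eq_of_mem_edge hvf
  obtain ⟨g, hg, hge, hag⟩ := exists_ne_mem_bdry he (u := a) (by rw [hea]; simp)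
  obtain ⟨w, hw, hwg⟩ := bdry_subset x hg
  have hgw : (g : Sym2 V) = s(w, a) :=
    (Sym2.mem_and_mem_iff (ne_of_mem_of_not_mem hw ha)).1 ⟨hwg, hag⟩
  obtain ⟨h, hh, hhg, hwh⟩ := exists_ne_mem_bdry hg hwg
  obtain ⟨c, -, hhc⟩ := exists_eq_of_mem_edge hwh
  refine ⟨v, hv, w, hw, ?_, a, b, c, ?_, ?_, e, f, g, h, hea, hfb, hgw, hhc, he, hf, hg, hh⟩
  · rintro rfl
    exact hge (Subtype.ext (hgw.trans hea.symm))
  · rintro rfl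
    exact hfe (Subtype.ext (hfb.trans hea.symm))
  · rintro rfl
    exact hhg (Subtype.ext (hhc.trans hgw.symm))

/-- The regions of a bipartite plane graph have at least four boundary edges. -/
theorem four_le_ncard_bdry_star (hJ : G.IsIndepSet J) {x : P.Off}
    (hne : (P.bdry (G.star J) x).Nonempty) : 4 ≤ (P.bdry (G.star J) x).ncard := by
  obtain ⟨v, hv, w, hw, hvw, a, b, c, hab, hac, e, f, g, h, he, hf, hg, hh, h1, h2, h3, h4⟩ :=
    exists_mem_bdry_star hJ hne
  have hvc : v ≠ c := by
    rintro rfl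
    have := h.2
    rw [hh, SimpleGraph.mem_edgeSet] at this
    exact hJ hw hv hvw.symm this
  have hva : v ≠ a := by
    rintro rfl
    have := e.2
    rw [he, SimpleGraph.mem_edgeSet] at this
    exact this.ne rfl
  have hsub : ({e, f, g, h} : Set G.edgeSet) ⊆ P.bdry (G.star J) x := by
    rintro _ (rfl | rfl | rfl | rfl) <;> assumption
  refine le_trans (le_of_eq ?_) (ncard_le_ncard hsub)
  have hne : ∀ e f : G.edgeSet, (e : Sym2 V) ≠ f → e ≠ f := fun e f h h' => h (by rw [h'])
  rw [ncard_insert_of_notMem, ncard_insert_of_notMem, ncard_pair]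
  · exact hne _ _ (by
      rw [hg, hh, Ne, Sym2.congr_right]; exact hac)
  · simp only [mem_insert_iff, mem_singleton_iff, not_or]
    exact ⟨hne _ _ (by rw [hf, hg]; simp [hvw, hva]), hne _ _ (by rw [hf, hh]; simp [hvw, hvc])⟩
  · simp only [mem_insert_iff, mem_singleton_iff, not_or]
    exact ⟨hne _ _ (by rw [he, hf, Ne, Sym2.congr_right]; exact hab),
      hne _ _ (by rw [he, hg]; simp [hvw, hva]), hne _ _ (by rw [he, hh]; simp [hvw, hvc])⟩

omit [Finite V] in
lemma star_singleton_eq (hv : G.neighborSet v = {a, b}) : ∃ e f : G.edgeSet,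
    (e : Sym2 V) = s(v, a) ∧ (f : Sym2 V) = s(v, b) ∧ G.star {v} = {e, f} := by
  have h : ∀ c, G.Adj v c ↔ c = a ∨ c = b := fun c => Set.ext_iff.1 hv c
  refine ⟨⟨s(v, a), (h a).2 (Or.inl rfl)⟩, ⟨s(v, b), (h b).2 (Or.inr rfl)⟩, rfl, rfl, ?_⟩
  ext e
  simp only [mem_star, mem_singleton_iff, exists_eq_left, mem_insert_iff]
  constructor
  · intro he
    obtain ⟨c, hc, hec⟩ := exists_eq_of_mem_edge he
    obtain rfl | rfl := (h c).1 hc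
    · exact Or.inl (Subtype.ext hec)
    · exact Or.inr (Subtype.ext hec)
  · rintro (rfl | rfl) <;> simp

/-- A region bounded by four edges incident to vertices of degree two is bounded by a cycle
through two vertices with the same neighbors. -/
theorem exists_bdry_star_eq (hJ : G.IsIndepSet J) (h2 : ∀ v ∈ J, (G.neighborSet v).ncard = 2)
    {x : P.Off} (h4 : (P.bdry (G.star J) x).ncard = 4) :
    ∃ v ∈ J, ∃ w ∈ J, v ≠ w ∧ ∃ a b, a ≠ b ∧ G.neighborSet v = {a, b} ∧
      G.neighborSet w = {a, b} ∧ P.bdry (G.star J) x = G.star {v, w} := by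
  obtain ⟨v, hv, w, hw, hvw, a, b, c, hab, hac, e, f, g, h, he, hf, hg, hh, he', hf', hg', hh'⟩ :=
    exists_mem_bdry_star hJ (nonempty_of_ncard_ne_zero (h4.trans_ne four_ne_zero))
  have hN : ∀ {v a b : V} {e f : G.edgeSet}, v ∈ J → a ≠ b → (e : Sym2 V) = s(v, a) →
      (f : Sym2 V) = s(v, b) → G.neighborSet v = {a, b} := by
    intro v a b e f hv hab he hf
    refine (eq_of_subset_of_ncard_le ?_ (by rw [h2 v hv, ncard_pair hab])).symm
    rintro _ (rfl | rfl)
    · rw [SimpleGraph.mem_neighborSet, ← SimpleGraph.mem_edgeSet, ← he]; exact e.2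
    · rw [SimpleGraph.mem_neighborSet, ← SimpleGraph.mem_edgeSet, ← hf]; exact f.2
  have hNv := hN hv hab he hf
  have hNw := hN hw hac hg hh
  have hstar : ∀ {v a b : V} {e f : G.edgeSet}, G.neighborSet v = {a, b} →
      (e : Sym2 V) = s(v, a) → (f : Sym2 V) = s(v, b) → G.star {v} = {e, f} := by
    intro v a b e f hN he hf
    obtain ⟨e', f', he', hf', h⟩ := star_singleton_eq hN
    rw [h, Subtype.ext (he.trans he'.symm), Subtype.ext (hf.trans hf'.symm)]
  have heq : P.bdry (G.star J) x = G.star {v, w} := by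
    classical
    refine (eq_of_subset_of_ncard_le ?_ ?_).symm
    · rw [star_insert, hstar hNv he hf, hstar hNw hg hh]
      rintro _ ((rfl | rfl) | (rfl | rfl)) <;> assumption
    · have := SimpleGraph.ncard_star {v, w}
        (hJ.mono (by simpa [insert_subset_iff] using ⟨hv, hw⟩))
      rw [Finset.sum_pair hvw, h2 v hv, h2 w hw, Finset.coe_pair] at this
      rw [h4, this]
  have hbc : b = c := by
    obtain ⟨k, hk, hkf, hbk⟩ := exists_ne_mem_bdry hf' (u := b) (by rw [hf]; simp)
    have hvb : G.Adj v b := by rw [← SimpleGraph.mem_neighborSet, hNv]; simp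
    rw [heq, star_insert, hstar hNv he hf, hstar hNw hg hh] at hk
    have hbw : b ≠ w := by
      rintro rfl
      exact hJ hv hw hvw hvb
    obtain (rfl | rfl) | (rfl | rfl) := hk
    · rw [he, Sym2.mem_iff] at hbk
      exact (hbk.elim hvb.ne.symm hab.symm).elim
    · exact absurd rfl hkf
    · rw [hg, Sym2.mem_iff] at hbk
      exact (hbk.elim hbw hab.symm).elim
    · rw [hh, Sym2.mem_iff] at hbk
      exact hbk.resolve_left hbw
  exact ⟨v, hv, w, hw, hvw, a, b, hab, hNv, hbc ▸ hNw, heq⟩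

/-- The number of regions cut out by a family is at most its size. -/
theorem card_region_star_insert_le (hab : a ≠ b) (K : Finset V)
    (hK : ∀ u ∈ insert v (K : Set V), G.neighborSet u = {a, b}) :
    Nat.card (Quotient (P.region (G.star (insert v (K : Set V))))) ≤ K.card + 1 := by
  classical
  have hirr : ∀ {u w : V}, G.neighborSet u = {a, b} → G.neighborSet w = {a, b} →
      ¬ G.Adj u w := by
    intro u w hu hw h
    rw [← SimpleGraph.mem_neighborSet, hu, ← hw] at h
    exact h.ne rfl
  induction K using Finset.induction_on with
  | empty =>
    have hv := hK v (mem_insert _ _)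
    obtain ⟨e, f, he, hf, h⟩ := star_singleton_eq hv
    have hav : a ≠ v := by
      have : G.Adj v a := by rw [← SimpleGraph.mem_neighborSet, hv]; simp
      exact this.ne.symm
    have h1 : P.region {e, f} = P.region {f} :=
      region_insert_of_isolated (u := a) (by rintro _ rfl; rw [hf]; simp [hav, hab])
        (by rw [he]; simp)
    have h2 : P.region {f} = P.region ∅ := by
      rw [← insert_empty_eq]
      exact region_insert_of_isolated (u := v) (by simp) (by rw [hf]; simp)
    rw [Finset.coe_empty, insert_empty_eq, h, h1, h2, card_region_empty, Finset.card_empty]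
  | @insert w K hw ih =>
    rw [Finset.card_insert_of_notMem hw, Finset.coe_insert, insert_comm]
    rw [Finset.coe_insert, insert_comm] at hK
    have ih := ih fun u hu => hK u (mem_insert_of_mem _ hu)
    by_cases hwv : w ∈ insert v (K : Set V)
    · rw [insert_eq_of_mem hwv]; omega
    have hwN := hK w (mem_insert _ _)
    obtain ⟨e, f, he, hf, h⟩ := star_singleton_eq hwN
    rw [star_insert, h, insert_union, singleton_union]
    have h1 : P.region (insert f (G.star (insert v (K : Set V)))) =
        P.region (G.star (insert v (K : Set V))) := by
      refine region_insert_of_isolated (u := w) ?_ (by rw [hf]; simp)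
      rintro g ⟨t, ht, htg⟩ hwg
      have := (Sym2.mem_and_mem_iff (ne_of_mem_of_not_mem ht hwv)).1 ⟨htg, hwg⟩
      have hg := g.2
      rw [this, SimpleGraph.mem_edgeSet] at hg
      exact hirr (hK t (mem_insert_of_mem _ ht)) hwN hg
    have h2 := (card_region_insert_le (P := P) (insert f (G.star (insert v (K : Set V)))) e).2
    rw [h1] at h2
    omega

end PlaneEmbedding

namespace PlaneEmbedding

open SimpleGraph (star_mono exists_eq_of_mem_edge)

variable {V : Type} [Finite V] {G : SimpleGraph V} {P : PlaneEmbedding G} {I J : Set V}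
  {a b v w : V}

lemma not_isBounded_univ_prod : ¬ IsBounded (univ : Set (ℝ × ℝ)) :=
  NormedSpace.unbounded_univ ℝ (ℝ × ℝ)

variable (P) in
lemma exists_not_isBounded_component {K : Set (ℝ × ℝ)} (hK : IsCompact K) :
    ∃ z : P.Off, ¬ IsBounded (connectedComponentIn Kᶜ z.1) := by
  obtain ⟨U, hUK, hUo, hU, hb⟩ := exists_isPreconnected_subset_compl hK
  have hUb : ¬ IsBounded U := fun h => not_isBounded_univ_prod (by
    rw [← union_compl_self U]; exact h.union hb)
  obtain ⟨z, hzU, hz⟩ := P.dense_compl_image.inter_open_nonempty U hUo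
    (nonempty_iff_ne_empty.2 fun h => hUb (h ▸ isBounded_empty))
  exact ⟨⟨z, hz⟩, fun h => hUb (h.subset (hU.subset_connectedComponentIn hzU hUK))⟩

/-- Two disjoint components of complements of compact sets are not both unbounded. -/
lemma isBounded_component_of_disjoint {K L : Set (ℝ × ℝ)} (hK : IsCompact K) {x y : ℝ × ℝ}
    (h : Disjoint (connectedComponentIn Kᶜ x) (connectedComponentIn Lᶜ y))
    (hx : ¬ IsBounded (connectedComponentIn Kᶜ x)) : IsBounded (connectedComponentIn Lᶜ y) := by
  refine (hK.isBounded.union (isBounded_compl_diff_component hK hx)).subset fun z hz => ?_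
  by_cases hzK : z ∈ K
  · exact Or.inl hzK
  · exact Or.inr ⟨hzK, fun h' => Set.disjoint_left.1 h h' hz⟩

omit [Finite V] in
/-- The ends of an arc are limits of its relative interior. -/
lemma exists_mem_arc_diff {e : G.edgeSet} (he : (e : Sym2 V) = s(v, w)) {W : Set (ℝ × ℝ)}
    (hW : IsOpen W) (hv : P.pos v ∈ W) : ∃ p ∈ P.arc e \ {P.pos v, P.pos w}, p ∈ W := by
  obtain ⟨γ, hγ, hr⟩ := P.exists_path e he
  have hd : Dense (Ioo (0 : unitInterval) 1) := by
    rw [dense_iff_closure_eq, closure_Ioo zero_ne_one]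
    exact Icc_bot_top
  obtain ⟨t, ht, ht'⟩ := hd.inter_open_nonempty _ (hW.preimage γ.continuous)
    ⟨0, by rwa [mem_preimage, γ.source]⟩
  refine ⟨γ t, ⟨hr ▸ mem_range_self t, ?_⟩, ht⟩
  rintro (h | h)
  · exact ht'.1.ne' (hγ (h.trans γ.source.symm))
  · exact ht'.2.ne (hγ ((mem_singleton_iff.1 h).trans γ.target.symm))

/-- If a region of the graph formed by the edges at the vertices of degree two of an independent
set is bounded by a cycle of length four, then this cycle encloses no vertex of `G` unless it
encloses one outside the independent set. -/
theorem notMem_component_of_bdry_eq (hI : G.IsIndepSet I)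
    (hdeg : ∀ v, 2 ≤ (G.neighborSet v).ncard) {S : Set G.edgeSet}
    (hS : S = G.star {v ∈ I | (G.neighborSet v).ncard = 2}) {x : P.Off}
    (hv : v ∈ I) (hw : w ∈ I) (hab : a ≠ b) (hNv : G.neighborSet v = {a, b})
    (hNw : G.neighborSet w = {a, b}) (hx : P.bdry S x = G.star {v, w})
    (hA : ∀ u ∉ I, P.pos u ∉ connectedComponentIn (P.drawing (P.bdry S x))ᶜ x.1) (t : V) :
    P.pos t ∉ connectedComponentIn (P.drawing (P.bdry S x))ᶜ x.1 := by
  intro ht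
  have htI : t ∈ I := by_contra fun h => hA t h ht
  set W := connectedComponentIn (P.drawing (P.bdry S x))ᶜ x.1 with hW
  have hadj : ∀ {u c}, G.neighborSet u = {a, b} → (G.Adj u c ↔ c = a ∨ c = b) :=
    fun hN => Set.ext_iff.1 hN _
  have haI : a ∉ I := fun h => by
    have := (hadj hNv).2 (Or.inl rfl)
    exact hI hv h this.ne this
  have htQ : ∀ e ∈ P.bdry S x, t ∉ (e : Sym2 V) := fun e he hte =>
    notMem_of_mem_component ht (P.pos_mem_drawing_iff.2 ⟨e, he, hte⟩)
  by_cases hNt : G.neighborSet t ⊆ {a, b}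
  · have hNt : G.neighborSet t = {a, b} :=
      eq_of_subset_of_ncard_le hNt (by rw [ncard_pair hab]; exact hdeg t)
    have hta : G.Adj t a := (hadj hNt).2 (Or.inl rfl)
    let e : G.edgeSet := ⟨s(t, a), hta⟩
    have heS : e ∈ S := hS.ge ⟨t, ⟨htI, by rw [hNt, ncard_pair hab]⟩, by simp [e]⟩
    have htv : t ≠ v := by
      rintro rfl
      exact htQ e (by rw [hx]; exact ⟨t, by simp, by simp [e]⟩) (by simp [e])
    have hmem : ∀ {u c : V} (h : G.Adj u c), (G.neighborSet u = {a, b}) → u ∈ I →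
        s(u, c) ≠ s(t, a) → (SimpleGraph.spanned (S \ {e})).Adj u c := fun {u c} h hN hu hne =>
      SimpleGraph.spanned_adj.2 ⟨⟨s(u, c), h⟩, ⟨hS.ge
        ⟨u, ⟨hu, by rw [hN, ncard_pair hab]⟩, by simp⟩, fun h => hne (congr_arg Subtype.val h)⟩,
        rfl⟩
    have hva : v ≠ a := fun h => haI (h ▸ hv)
    have hcut : ¬ SimpleGraph.IsCutEdge S e := by
      rw [SimpleGraph.isCutEdge_iff (u := t) (v := a) rfl, not_not]
      have h1 := hmem ((hadj hNt).2 (Or.inr rfl)) hNt htI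
        (by rw [Ne, Sym2.congr_right]; exact hab.symm)
      have h2 := hmem ((hadj hNv).2 (Or.inr rfl)) hNv hv (by simp [htv.symm, hva])
      have h3 := hmem ((hadj hNv).2 (Or.inl rfl)) hNv hv
        (by rw [Ne, Sym2.congr_left]; exact htv.symm)
      exact h1.reachable.trans (h2.symm.reachable.trans h3.reachable)
    have hdisj := disjoint_component_arc heS hcut fun h => htQ e h (by simp [e])
    have hWo : IsOpen W := isOpen_component (P.isCompact_drawing _).isClosed _
    obtain ⟨p, hp, hpW⟩ := exists_mem_arc_diff (e := e) rfl hWo ht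
    have hpS : p ∉ P.drawing (S \ {e}) := fun h =>
      hp.2 (P.drawing_inter_arc_subset (fun h => h.2 rfl) rfl ⟨h, hp.1⟩)
    obtain ⟨z, ⟨hzW, hzp⟩, hz⟩ := P.dense_compl_image.inter_open_nonempty _
      (hWo.inter (isOpen_component (P.isCompact_drawing (S \ {e})).isClosed p))
      ⟨p, hpW, mem_component_self hpS⟩
    have hxz : P.region (S \ {e}) x ⟨z, hz⟩ :=
      region_mono sdiff_subset (region_of_region_bdry (y := ⟨z, hz⟩) hzW)
    refine Set.disjoint_left.1 hdisj ?_ hp.1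
    rw [connectedComponentIn_eq hxz]
    exact component_symm hpS hzp
  · obtain ⟨y, hty, hy⟩ := not_subset.1 hNt
    have hyI : y ∉ I := fun h => hI htI h (SimpleGraph.Adj.ne hty) hty
    let e : G.edgeSet := ⟨s(t, y), hty⟩
    have hyQ : ∀ f ∈ P.bdry S x, y ∉ (f : Sym2 V) := by
      intro f hf hyf
      rw [hx] at hf
      obtain ⟨u, hu, huf⟩ := hf
      have hNu : G.neighborSet u = {a, b} := by
        obtain rfl | rfl := hu <;> assumption
      have huI : u ∈ I := by
        obtain rfl | rfl := hu <;> assumption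
      obtain ⟨c, hc, hfc⟩ := exists_eq_of_mem_edge huf
      rw [hfc, Sym2.mem_iff] at hyf
      obtain rfl | rfl := hyf
      · exact hyI huI
      · exact hy ((hadj hNu).1 hc)
    have hdisj : P.arc e ⊆ (P.drawing (P.bdry S x))ᶜ := by
      intro z hze hz
      have heQ : e ∉ P.bdry S x := fun h => htQ e h (by simp [e])
      obtain rfl | rfl := P.drawing_inter_arc_subset heQ (u := t) (v := y) rfl ⟨hz, hze⟩
      · obtain ⟨f, hf, htf⟩ := P.pos_mem_drawing_iff.1 hz
        exact htQ f hf htf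
      · obtain ⟨f, hf, hyf⟩ := P.pos_mem_drawing_iff.1 hz
        exact hyQ f hf hyf
    have hconn : IsPreconnected (P.arc e) := by
      obtain ⟨γ, -, hr⟩ := P.exists_path e (u := t) (v := y) rfl
      exact hr ▸ isPreconnected_range γ.continuous
    refine hA y hyI ?_
    rw [hW, connectedComponentIn_eq ht]
    exact hconn.subset_connectedComponentIn (P.pos_mem_arc (by simp [e])) hdisj
      (P.pos_mem_arc (by simp [e]))

/-- Two regions without vertices, bounded by cycles of length four that share a vertex of degree
two, give rise to a nicely embedded family. -/
theorem exists_nicelyEmbedded {S : Set G.edgeSet} {x x' : P.Off} (hxx' : ¬ P.region S x x')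
    {w' : V} (hvw : v ≠ w) (hvw' : v ≠ w') (hab : a ≠ b) (hNv : G.neighborSet v = {a, b})
    (hNw : G.neighborSet w = {a, b}) (hNw' : G.neighborSet w' = {a, b})
    (hx : P.bdry S x = G.star {v, w}) (hx' : P.bdry S x' = G.star {v, w'})
    (hb : IsBounded (connectedComponentIn (P.drawing (P.bdry S x))ᶜ x.1))
    (hb' : IsBounded (connectedComponentIn (P.drawing (P.bdry S x'))ᶜ x'.1))
    (hemp : ∀ t, P.pos t ∉ connectedComponentIn (P.drawing (P.bdry S x))ᶜ x.1)
    (hemp' : ∀ t, P.pos t ∉ connectedComponentIn (P.drawing (P.bdry S x'))ᶜ x'.1) :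
    ∃ R, IsRFamily G R 3 ∧ P.NicelyEmbedded R := by
  classical
  set T := G.star {v, w, w'} with hT
  have hQT : P.bdry S x ⊆ T := by
    rw [hx]; exact star_mono (by intro u; simp; tauto)
  have hQT' : P.bdry S x' ⊆ T := by
    rw [hx']; exact star_mono (by intro u; simp; tauto)
  have hsub : connectedComponentIn (P.drawing T)ᶜ x.1 ⊆
      connectedComponentIn (P.drawing (P.bdry S x))ᶜ x.1 :=
    connectedComponentIn_mono _ (compl_subset_compl.2 (P.drawing_mono hQT))
  have hsub' : connectedComponentIn (P.drawing T)ᶜ x'.1 ⊆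
      connectedComponentIn (P.drawing (P.bdry S x'))ᶜ x'.1 :=
    connectedComponentIn_mono _ (compl_subset_compl.2 (P.drawing_mono hQT'))
  obtain ⟨z, hz⟩ := P.exists_not_isBounded_component (P.isCompact_drawing T)
  have hxz : ¬ P.region T x z := fun h =>
    hz ((hb.subset hsub).subset (connectedComponentIn_eq h).symm.subset)
  have hxz' : ¬ P.region T x' z := fun h =>
    hz ((hb'.subset hsub').subset (connectedComponentIn_eq h).symm.subset)
  have hxxT : ¬ P.region T x x' := fun h =>
    hxx' (region_of_region_bdry (region_mono hQT h))
  let q : P.Off → Quotient (P.region T) := Quotient.mk _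
  have hq : ∀ {y z}, q y = q z ↔ P.region T y z := Quotient.eq
  have h3 : ({q x, q x', q z} : Set (Quotient (P.region T))).ncard = 3 := by
    rw [ncard_insert_of_notMem, ncard_pair]
    · rwa [Ne, hq]
    · simp only [mem_insert_iff, mem_singleton_iff, hq, not_or]
      exact ⟨hxxT, hxz⟩
  have hcard : Nat.card (Quotient (P.region T)) ≤ ({w, w'} : Finset V).card + 1 := by
    have := P.card_region_star_insert_le (v := v) hab {w, w'} (by
      simpa using ⟨hNv, hNw, hNw'⟩)
    rwa [Finset.coe_pair] at this
  have hle := ncard_le_card ({q x, q x', q z} : Set (Quotient (P.region T)))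
  have hww' : w ≠ w' := by
    rintro rfl
    rw [Finset.pair_eq_singleton, Finset.card_singleton] at hcard
    omega
  rw [Finset.card_pair hww'] at hcard
  have huniv : ({q x, q x', q z} : Set (Quotient (P.region T))) = univ :=
    eq_of_subset_of_ncard_le (subset_univ _) (by rw [ncard_univ]; omega)
  refine ⟨{v, w, w'}, ⟨?_, a, b, hab, ?_⟩, ?_⟩
  · rw [ncard_insert_of_notMem (by simp [hvw, hvw']), ncard_pair hww']
  · rintro _ (rfl | rfl | rfl) <;> assumption
  intro y hy hyb t ht
  change y ∉ P.drawing T at hy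
  change IsBounded (connectedComponentIn (P.drawing T)ᶜ y) at hyb
  change P.pos t ∈ connectedComponentIn (P.drawing T)ᶜ y at ht
  obtain ⟨s, hs, hsO⟩ := P.dense_compl_image.inter_open_nonempty _
    (isOpen_component (P.isCompact_drawing T).isClosed y) ⟨y, mem_component_self hy⟩
  rw [connectedComponentIn_eq hs] at ht hyb
  have hclass : q ⟨s, hsO⟩ ∈ ({q x, q x', q z} : Set (Quotient (P.region T))) :=
    huniv ▸ mem_univ _
  obtain h | h | h := hclass
  · rw [connectedComponentIn_eq (hq.1 h)] at ht
    exact hemp t (hsub ht)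
  · rw [connectedComponentIn_eq (hq.1 h)] at ht
    exact hemp' t (hsub' ht)
  · rw [connectedComponentIn_eq (hq.1 h)] at hyb
    exact hz hyb

end PlaneEmbedding

namespace SimpleGraph

variable {V : Type} [Finite V] {G : SimpleGraph V} {J I : Set V}

/-- A maximum matching leaves an independent set uncovered. -/
lemma exists_isMatching_isIndepSet_compl (G : SimpleGraph V) :
    ∃ M : G.Subgraph, M.IsMatching ∧ G.IsIndepSet M.vertsᶜ := by
  obtain ⟨M, hM, hmax⟩ := exists_max_image {M : G.Subgraph | M.IsMatching} (·.verts.ncard)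
    (toFinite _) ⟨⊥, fun v hv => hv.elim⟩
  refine ⟨M, hM, fun u hu v hv _ huv => ?_⟩
  have hsup : (M ⊔ G.subgraphOfAdj huv).IsMatching := by
    refine Subgraph.IsMatching.sup hM (Subgraph.IsMatching.subgraphOfAdj huv) ?_
    rw [Set.disjoint_left]
    intro w hw hw'
    obtain rfl | rfl : w = u ∨ w = v := by
      simpa using Subgraph.support_subset_verts _ hw'
    · exact hu (M.support_subset_verts hw)
    · exact hv (M.support_subset_verts hw)
  have hlt : M.verts.ncard < (M ⊔ G.subgraphOfAdj huv).verts.ncard := by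
    refine ncard_lt_ncard ⟨subset_union_left, fun h => hu (h ?_)⟩
    simp
  exact absurd (hmax _ hsup) (not_le.2 hlt)

lemma Subgraph.IsMatching.ncard_verts_le {M : G.Subgraph} (hM : M.IsMatching) :
    M.verts.ncard ≤ 2 * M.edgeSet.ncard := by
  classical
  have hfin := toFinite M.edgeSet
  have := hfin.fintype
  have h : M.verts = ⋃ e ∈ M.edgeSet.toFinset, (e : Set V) := by
    rw [hM.verts_eq_biUnion_edgeSet]
    simp
  rw [h, ncard_eq_toFinset_card' M.edgeSet, mul_comm, ← smul_eq_mul]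
  refine (Finset.set_ncard_biUnion_le _ _).trans (Finset.sum_le_card_nsmul _ _ _ fun e _ => ?_)
  induction e with
  | _ u v => rw [Sym2.coe_mk]; exact (ncard_insert_le _ _).trans (by rw [ncard_singleton])

lemma mul_ncard_le_ncard_star (hJ : G.IsIndepSet J) {d : ℕ}
    (hd : ∀ v ∈ J, d ≤ (G.neighborSet v).ncard) : d * J.ncard ≤ (G.star J).ncard := by
  obtain ⟨J, rfl⟩ := (toFinite J).exists_finset_coe
  rw [ncard_star J hJ, ncard_coe_finset, mul_comm, ← smul_eq_mul]
  exact Finset.card_nsmul_le_sum _ _ _ hd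

lemma ncard_star_eq_mul (hJ : G.IsIndepSet J) {d : ℕ}
    (hd : ∀ v ∈ J, (G.neighborSet v).ncard = d) : (G.star J).ncard = d * J.ncard := by
  obtain ⟨J, rfl⟩ := (toFinite J).exists_finset_coe
  rw [ncard_star J hJ, ncard_coe_finset, mul_comm, ← smul_eq_mul]
  exact Finset.sum_const_nat hd

end SimpleGraph

namespace PlaneEmbedding

open SimpleGraph (exists_eq_of_mem_edge)

variable {V : Type} [Finite V] {G : SimpleGraph V} {P : PlaneEmbedding G} {I J : Set V}

/-- The Euler inequality for the edges incident to part of an independent set. -/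
lemma ncard_star_add_two_le (hI : G.IsIndepSet I) (hIne : (Iᶜ).Nonempty) (hJ : J ⊆ I) :
    (G.star J).ncard + 2 ≤ Nat.card (Quotient (P.region (G.star J))) + J.ncard + (Iᶜ).ncard := by
  refine (ncard_add_two_le_card_region_add (P := P)
    (hIne.mono subset_union_right : (J ∪ Iᶜ).Nonempty) ?_).trans ?_
  · rintro e ⟨v, hv, hve⟩ w hw
    obtain ⟨c, hc, hec⟩ := exists_eq_of_mem_edge hve
    rw [hec, Sym2.mem_iff] at hw
    obtain rfl | rfl := hw
    · exact Or.inl hv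
    · exact Or.inr fun h => hI (hJ hv) h hc.ne hc
  · have := ncard_union_le J Iᶜ
    omega

lemma four_le_ncard_bdry_out (hJ : G.IsIndepSet J)
    (hF : 1 < Nat.card (Quotient (P.region (G.star J)))) (f : Quotient (P.region (G.star J))) :
    4 ≤ (P.bdry (G.star J) f.out).ncard := by
  have := Finite.one_lt_card_iff_nontrivial.1 hF
  obtain ⟨g, hg⟩ := exists_ne f
  refine four_le_ncard_bdry_star hJ (bdry_nonempty (y := g.out) fun h => hg ?_)
  rw [← f.out_eq, ← g.out_eq]
  exact (Quotient.sound h).symm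

/-- An independent set of vertices of degree at least three is at most twice as large as its
complement. -/
theorem ncard_le_of_three_le_degree (P : PlaneEmbedding G) (hI : G.IsIndepSet I)
    (hIne : (Iᶜ).Nonempty) (hJ : J ⊆ I) (h3 : ∀ v ∈ J, 3 ≤ (G.neighborSet v).ncard) :
    J.ncard ≤ 2 * (Iᶜ).ncard := by
  classical
  have := Fintype.ofFinite (Quotient (P.region (G.star J)))
  have h1 := ncard_star_add_two_le (P := P) hI hIne hJ
  have h2 := SimpleGraph.mul_ncard_le_ncard_star (hI.mono hJ) h3
  by_cases hF : 1 < Nat.card (Quotient (P.region (G.star J)))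
  · have h4 := (Finset.card_nsmul_le_sum Finset.univ _ 4 fun f _ =>
      four_le_ncard_bdry_out (hI.mono hJ) hF f).trans (sum_ncard_bdry_le (P := P) (G.star J))
    rw [Finset.card_univ, ← Nat.card_eq_fintype_card, smul_eq_mul] at h4
    omega
  · omega

/-- Without nicely embedded families, few regions are bounded by four edges. -/
theorem two_mul_card_le (hI : G.IsIndepSet I) (hdeg : ∀ v, 2 ≤ (G.neighborSet v).ncard)
    (hfam : ∀ R, IsRFamily G R 3 → ¬ P.NicelyEmbedded R)
    (hJ : J = {v ∈ I | (G.neighborSet v).ncard = 2}) (s : Finset (Quotient (P.region (G.star J))))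
    (hs : ∀ f ∈ s, (P.bdry (G.star J) f.out).ncard = 4) :
    2 * s.card ≤ 2 * (Iᶜ).ncard + J.ncard + 2 := by
  classical
  have hJI : J ⊆ I := fun v hv => by rw [hJ] at hv; exact hv.1
  have hJ2 : ∀ v ∈ J, (G.neighborSet v).ncard = 2 := fun v hv => by rw [hJ] at hv; exact hv.2
  let W : Quotient (P.region (G.star J)) → Set (ℝ × ℝ) := fun f =>
    connectedComponentIn (P.drawing (P.bdry (G.star J) f.out))ᶜ f.out.1
  have hreg : ∀ {f g : Quotient (P.region (G.star J))}, f ≠ g →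
      ¬ P.region (G.star J) f.out g.out := fun {f g} hfg h =>
    hfg (by rw [← f.out_eq, ← g.out_eq]; exact Quotient.sound h)
  have hdisj : ∀ {f g}, f ≠ g → Disjoint (W f) (W g) := fun hfg =>
    disjoint_component_bdry (hreg hfg)
  let α := s.filter fun f => ∃ u ∉ I, P.pos u ∈ W f
  let γ := s.filter fun f => ¬ IsBounded (W f)
  let β := s.filter fun f => IsBounded (W f) ∧ ∀ u ∉ I, P.pos u ∉ W f
  have hcover : s ⊆ (α ∪ γ) ∪ β := by
    intro f hf
    simp only [α, β, γ, Finset.mem_union, Finset.mem_filter]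
    by_cases h1 : IsBounded (W f)
    · by_cases h2 : ∃ u ∉ I, P.pos u ∈ W f
      · exact Or.inl (Or.inl ⟨hf, h2⟩)
      · push Not at h2
        exact Or.inr ⟨hf, h1, h2⟩
    · exact Or.inl (Or.inr ⟨hf, h1⟩)
  have hα : α.card ≤ (Iᶜ).ncard := by
    have : ∀ f : α, ∃ u ∉ I, P.pos u ∈ W f := fun f => (Finset.mem_filter.1 f.2).2
    choose u hu hu' using this
    rw [← Nat.card_coe_set_eq, ← Fintype.card_coe, ← Nat.card_eq_fintype_card]
    refine Nat.card_le_card_of_injective (fun f => (⟨u f, hu f⟩ : (Iᶜ : Set V))) fun f g hfg => ?_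
    by_contra hne
    refine Set.disjoint_left.1 (hdisj fun h => hne (Subtype.ext h)) (hu' f) ?_
    rw [show u f = u g from congr_arg Subtype.val hfg]
    exact hu' g
  have hγ : γ.card ≤ 1 := by
    refine Finset.card_le_one.2 fun f hf g hg => ?_
    by_contra hne
    exact (Finset.mem_filter.1 hg).2 (isBounded_component_of_disjoint (P.isCompact_drawing _)
      (hdisj hne) (Finset.mem_filter.1 hf).2)
  have hβ : β.card * 2 ≤ J.ncard := by
    have := (toFinite J).fintype
    rw [ncard_eq_toFinset_card', ← mul_one J.toFinset.card]
    refine Finset.card_mul_le_card_mul (fun f v => ∃ w a b, v ≠ w ∧ a ≠ b ∧ v ∈ J ∧ w ∈ J ∧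
      G.neighborSet v = {a, b} ∧ G.neighborSet w = {a, b} ∧
      P.bdry (G.star J) f.out = G.star {v, w}) ?_ ?_
    · intro f hf
      obtain ⟨v, hv, w, hw, hvw, a, b, hab, hNv, hNw, hQ⟩ :=
        exists_bdry_star_eq (hI.mono hJI) hJ2 (hs f (Finset.mem_filter.1 hf).1)
      refine Finset.one_lt_card.2 ⟨v, ?_, w, ?_, hvw⟩
      · rw [Finset.bipartiteAbove, Finset.mem_filter, mem_toFinset]
        exact ⟨hv, w, a, b, hvw, hab, hv, hw, hNv, hNw, hQ⟩
      · rw [Finset.bipartiteAbove, Finset.mem_filter, mem_toFinset]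
        exact ⟨hw, v, a, b, hvw.symm, hab, hw, hv, hNw, hNv, by rw [hQ, pair_comm]⟩
    · intro v _
      refine Finset.card_le_one.2 fun f hf g hg => ?_
      simp only [Finset.bipartiteBelow, Finset.mem_filter, β] at hf hg
      obtain ⟨⟨-, hfb, hfA⟩, w, a, b, hvw, hab, hv, hw, hNv, hNw, hQ⟩ := hf
      obtain ⟨⟨-, hgb, hgA⟩, w', a', b', hvw', hab', -, hw', hNv', hNw', hQ'⟩ := hg
      by_contra hne
      obtain ⟨R, hR, hR'⟩ := exists_nicelyEmbedded (hreg hne) hvw hvw' hab hNv hNw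
        (hNw'.trans (hNv'.symm.trans hNv)) hQ hQ' hfb hgb
        (notMem_component_of_bdry_eq hI hdeg (congr_arg _ hJ) (hJI hv) (hJI hw) hab hNv hNw hQ hfA)
        (notMem_component_of_bdry_eq hI hdeg (congr_arg _ hJ) (hJI hv) (hJI hw') hab' hNv' hNw' hQ'
          hgA)
      exact hfam R hR hR'
  have h1 := Finset.card_le_card hcover
  have h2 := Finset.card_union_le (α ∪ γ) β
  have h3 := Finset.card_union_le α γ
  omega

/-- Without nicely embedded families, the vertices of degree two of an independent set are at most
twelve times as numerous as the vertices outside the set. -/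
theorem ncard_le_of_degree_eq_two (hI : G.IsIndepSet I) (hIne : (Iᶜ).Nonempty)
    (hdeg : ∀ v, 2 ≤ (G.neighborSet v).ncard)
    (hfam : ∀ R, IsRFamily G R 3 → ¬ P.NicelyEmbedded R)
    (hJ : J = {v ∈ I | (G.neighborSet v).ncard = 2}) : J.ncard ≤ 12 * (Iᶜ).ncard := by
  classical
  have hJI : J ⊆ I := fun v hv => by rw [hJ] at hv; exact hv.1
  have hJ2 : ∀ v ∈ J, (G.neighborSet v).ncard = 2 := fun v hv => by rw [hJ] at hv; exact hv.2
  have := Fintype.ofFinite (Quotient (P.region (G.star J)))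
  have h1 := ncard_star_add_two_le (P := P) hI hIne hJI
  have h2 := SimpleGraph.ncard_star_eq_mul (hI.mono hJI) hJ2
  by_cases hF : 1 < Nat.card (Quotient (P.region (G.star J)))
  · let s : Finset (Quotient (P.region (G.star J))) :=
      Finset.univ.filter fun f => (P.bdry (G.star J) f.out).ncard = 4
    have h3 := two_mul_card_le hI hdeg hfam hJ s fun f hf => (Finset.mem_filter.1 hf).2
    have h4 : Nat.card (Quotient (P.region (G.star J))) * 5 ≤ 2 * (G.star J).ncard + s.card := by
      refine le_trans ?_ (Nat.add_le_add_right (sum_ncard_bdry_le (P := P) (G.star J)) _)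
      rw [Finset.card_filter, ← Finset.sum_add_distrib, Nat.card_eq_fintype_card,
        ← Finset.card_univ, ← smul_eq_mul]
      refine Finset.card_nsmul_le_sum _ _ _ fun f _ => ?_
      have := four_le_ncard_bdry_out (hI.mono hJI) hF f
      split_ifs <;> omega
    omega
  · omega

end PlaneEmbedding

/-- A connected plane graph on `n` vertices with minimum degree 2
containing no nicely embedded `r`-family for any `r ≥ 3` has a matching of size at
least `n/37`. -/
theorem matching_of_no_nicely_embedded_family {V : Type} [Fintype V]
    {G : SimpleGraph V} (P : PlaneEmbedding G)
    (hconn : G.Connected)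
    (hdeg : ∀ v : V, 2 ≤ (G.neighborSet v).ncard)
    (hfam : ∀ r : ℕ, 3 ≤ r → ∀ R : Set V, IsRFamily G R r → ¬ P.NicelyEmbedded R) :
    ∃ M : G.Subgraph, M.IsMatching ∧
      Fintype.card V ≤ 37 * M.edgeSet.ncard := by
  obtain ⟨M, hM, hI⟩ := G.exists_isMatching_isIndepSet_compl
  refine ⟨M, hM, ?_⟩
  have hne : (M.vertsᶜᶜ).Nonempty := by
    obtain ⟨v⟩ := hconn.nonempty
    obtain ⟨w, hw⟩ := nonempty_of_ncard_ne_zero (s := G.neighborSet v)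
      (by have := hdeg v; omega)
    by_contra h
    rw [not_nonempty_iff_eq_empty, compl_empty_iff] at h
    exact hI (h ▸ mem_univ v) (h ▸ mem_univ w) (SimpleGraph.Adj.ne hw) hw
  have h2 := PlaneEmbedding.ncard_le_of_degree_eq_two (P := P) hI hne hdeg (hfam 3 le_rfl) rfl
  have h3 := P.ncard_le_of_three_le_degree (J := {v ∈ M.vertsᶜ | 3 ≤ (G.neighborSet v).ncard})
    hI hne (fun v hv => hv.1) fun v hv => hv.2
  have h4 := hM.ncard_verts_le
  have h5 := ncard_union_le {v ∈ M.vertsᶜ | (G.neighborSet v).ncard = 2}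
    {v ∈ M.vertsᶜ | 3 ≤ (G.neighborSet v).ncard}
  have h6 : M.vertsᶜ ⊆ {v ∈ M.vertsᶜ | (G.neighborSet v).ncard = 2} ∪
      {v ∈ M.vertsᶜ | 3 ≤ (G.neighborSet v).ncard} := by
    intro v hv
    obtain h | h := (hdeg v).eq_or_lt
    · exact Or.inl ⟨hv, h.symm⟩
    · exact Or.inr ⟨hv, h⟩
  have h7 := ncard_le_ncard h6
  have h8 := ncard_add_ncard_compl M.verts
  rw [Nat.card_eq_fintype_card] at h8
  rw [compl_compl] at h2 h3
  omega
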